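/- arXiv:2312.07043 — 6 statements merged into one kernel-verified Lean document; each statement's English description precedes it below -/
import Mathlib

section
/- Let n ≥ 1 and let s : {1,…,n} → ℚ be nonnegative. Let G be the graph with vertices c_1, c_2 and l_i, l'_i for i = 1,…,n, whose edges are c_j l_i for all j ∈ {1,2} and i ∈ {1,…,n}, together with l_i l'_i for all i ∈ {1,…,n}. Let A = {a_1, a_2} be two agents with identical utilities given by u_{a_1}(l_i l'_i) = u_{a_2}(l_i l'_i) = s(i) for every i, and utility 0 on every other edge. If there exists a set T ⊆ {1,…,n} with Σ_{i∈T} s(i) = Σ_{i∉T} s(i), then there exist a vertex-disjoint partition Π of G into pieces and an envy-free assignment π : A → Π. -/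
namespace GraphCutting

variable {V : Type*} [LinearOrder V]

/-- The edges of `G`, represented as ordered pairs `(u,v)` with `u < v`;
endpoint `0` of the unit interval corresponds to `u` and endpoint `1` to `v`. -/
abbrev Edges (G : SimpleGraph V) : Type _ := {p : V × V // p.1 < p.2 ∧ G.Adj p.1 p.2}

/-- The interval `I` of a piece `(e,I)` of an edge contains the endpoint of `e`
corresponding to the vertex `v`. -/
def EndptIn (G : SimpleGraph V) (e : Edges G) (I : Set ℝ) (v : V) : Prop :=
  (v = e.val.1 ∧ (0 : ℝ) ∈ I) ∨ (v = e.val.2 ∧ (1 : ℝ) ∈ I)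

/-- Two pieces of (distinct) edges are adjacent if the two edges share a vertex `v` and
both intervals contain the endpoint corresponding to `v`. -/
def PieceAdj (G : SimpleGraph V) (x y : Edges G × Set ℝ) : Prop :=
  x.1 ≠ y.1 ∧ ∃ v : V, EndptIn G x.1 x.2 v ∧ EndptIn G y.1 y.2 v

/-- A piece of the graph `G`: a finite collection of pieces of edges (each interval being
an interval contained in `[0,1]`) in which any two members are joined by a finite sequence
of consecutively adjacent pieces of edges from the collection. -/
def IsPiece (G : SimpleGraph V) (P : Finset (Edges G × Set ℝ)) : Prop :=
  (∀ x ∈ P, x.2 ⊆ Set.Icc (0 : ℝ) 1 ∧ x.2.OrdConnected) ∧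
  ∀ x ∈ P, ∀ y ∈ P,
    Relation.ReflTransGen (fun a b => a ∈ P ∧ b ∈ P ∧ PieceAdj G a b) x y

/-- A partition of `G` into pieces: every point `α` of every edge lies in precisely one
piece of an edge of precisely one member of the partition. -/
def IsPartition (G : SimpleGraph V) (Part : Set (Finset (Edges G × Set ℝ))) : Prop :=
  (∀ P ∈ Part, IsPiece G P) ∧
  ∀ e : Edges G, ∀ α ∈ Set.Icc (0 : ℝ) 1,
    ∃! PI : Finset (Edges G × Set ℝ) × Set ℝ,
      PI.1 ∈ Part ∧ (e, PI.2) ∈ PI.1 ∧ α ∈ PI.2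

/-- A partition is vertex-disjoint if all pieces of edges whose interval contains the
endpoint corresponding to a vertex `v` belong to the same member of the partition. -/
def IsVertexDisjoint (G : SimpleGraph V) (Part : Set (Finset (Edges G × Set ℝ))) : Prop :=
  ∀ v : V, ∀ P ∈ Part, ∀ Q ∈ Part, ∀ x ∈ P, ∀ y ∈ Q,
    EndptIn G x.1 x.2 v → EndptIn G y.1 y.2 v → P = Q

/-- The length of an interval of reals. -/
noncomputable def len (I : Set ℝ) : ℝ := sSup I - sInf I

/-- The utility of a piece of the graph w.r.t. an edge-utility function `u`. -/
noncomputable def util (G : SimpleGraph V) (u : Edges G → ℚ)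
    (P : Finset (Edges G × Set ℝ)) : ℝ :=
  ∑ x ∈ P, len x.2 * (u x.1 : ℝ)

/-- `π` is an envy-free assignment of the agents in `A` to the members of the
partition `Part`: it is a bijection onto `Part` and no agent envies another. -/
def IsEFAssignment {A : Type*} (G : SimpleGraph V) (u : A → Edges G → ℚ)
    (Part : Set (Finset (Edges G × Set ℝ))) (π : A → Finset (Edges G × Set ℝ)) : Prop :=
  Function.Injective π ∧ Set.range π = Part ∧
    ∀ a a' : A, util G (u a) (π a') ≤ util G (u a) (π a)

end GraphCutting

namespace GraphCutting

/-- The graph with vertices `c₁ = 0`, `c₂ = 1`, `lᵢ = 2i`, `l'ᵢ = 2i+1` (for `1 ≤ i ≤ n`),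
and edges `c₁ lᵢ`, `c₂ lᵢ`, and `lᵢ l'ᵢ` for all `1 ≤ i ≤ n`. -/
def matchPlusTwo (n : ℕ) : SimpleGraph ℕ :=
  SimpleGraph.fromRel (fun x y =>
    ∃ i, 1 ≤ i ∧ i ≤ n ∧
      ((x = 0 ∧ y = 2 * i) ∨ (x = 1 ∧ y = 2 * i) ∨ (x = 2 * i ∧ y = 2 * i + 1)))

/-- Both agents value the edge `lᵢ l'ᵢ = (2i, 2i+1)` at `s i` and every other edge at `0`.
(The edges `lᵢ l'ᵢ` are precisely those whose smaller endpoint is `≥ 2`.) -/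
def matchUtil (n : ℕ) (s : ℕ → ℚ) (e : Edges (matchPlusTwo n)) : ℚ :=
  if 2 ≤ e.val.1 then s (e.val.1 / 2) else 0

section Coloring

variable {V : Type*} [LinearOrder V] {C : Type*} (G : SimpleGraph V) (c : V → C)

/-- The part of the edge `e` given to the colour `b`: the point `1` follows the colour of the
larger endpoint, all other points follow the colour of the smaller one. -/
def colorInterval (b : C) (e : Edges G) : Set ℝ :=
  {α | α ∈ Set.Icc (0 : ℝ) 1 ∧ ((α < 1 ∧ c e.val.1 = b) ∨ (α = 1 ∧ c e.val.2 = b))}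

open Classical in
/-- The collection of all pieces of edges given to the colour `b`. -/
noncomputable def colorPiece [Fintype (Edges G)] (b : C) : Finset (Edges G × Set ℝ) :=
  (Finset.univ.filter fun e : Edges G => c e.val.1 = b ∨ c e.val.2 = b).image
    fun e => (e, colorInterval G c b e)

variable {G c}

lemma zero_mem_colorInterval {b : C} {e : Edges G} :
    (0 : ℝ) ∈ colorInterval G c b e ↔ c e.val.1 = b := by
  simp [colorInterval]

lemma one_mem_colorInterval {b : C} {e : Edges G} :
    (1 : ℝ) ∈ colorInterval G c b e ↔ c e.val.2 = b := by
  simp [colorInterval]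

lemma endptIn_colorInterval {b : C} {e : Edges G} {v : V} :
    EndptIn G e (colorInterval G c b e) v ↔ (v = e.val.1 ∨ v = e.val.2) ∧ c v = b := by
  unfold EndptIn
  rw [zero_mem_colorInterval, one_mem_colorInterval]
  constructor
  · rintro (⟨rfl, h⟩ | ⟨rfl, h⟩) <;> simp [h]
  · rintro ⟨rfl | rfl, h⟩ <;> simp [h]

lemma ordConnected_colorInterval (b : C) (e : Edges G) :
    (colorInterval G c b e).OrdConnected := by
  refine ⟨fun x hx y hy z hz => ?_⟩
  obtain ⟨⟨hx0, hx1⟩, hx⟩ := hx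
  obtain ⟨⟨hy0, hy1⟩, hy⟩ := hy
  refine ⟨⟨hx0.trans hz.1, hz.2.trans hy1⟩, ?_⟩
  rcases (hz.2.trans hy1).lt_or_eq with h | h
  · rcases hx with hx | hx
    · exact Or.inl ⟨h, hx.2⟩
    · linarith [hz.1, hx.1]
  · rcases hy with hy | hy
    · linarith [hz.2, hy.1]
    · exact Or.inr ⟨h, hy.2⟩

lemma colorInterval_eq_Icc {b : C} {e : Edges G} (h₁ : c e.val.1 = b) (h₂ : c e.val.2 = b) :
    colorInterval G c b e = Set.Icc 0 1 := by
  ext α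
  simp only [colorInterval, h₁, h₂, and_true, Set.mem_ofPred_eq, and_iff_left_iff_imp]
  exact fun h => h.2.lt_or_eq

variable [Fintype (Edges G)]

lemma mem_colorPiece {b : C} {e : Edges G} {I : Set ℝ} :
    (e, I) ∈ colorPiece G c b ↔
      (c e.val.1 = b ∨ c e.val.2 = b) ∧ I = colorInterval G c b e := by
  classical
  simp only [colorPiece, Finset.mem_image, Finset.mem_filter, Finset.mem_univ, true_and,
    Prod.mk.injEq]
  constructor
  · rintro ⟨e', h, rfl, rfl⟩
    exact ⟨h, rfl⟩
  · rintro ⟨h, rfl⟩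
    exact ⟨e, h, rfl, rfl⟩

lemma isPartition_range_colorPiece (h : ∀ b, IsPiece G (colorPiece G c b)) :
    IsPartition G (Set.range (colorPiece G c)) := by
  refine ⟨by rintro _ ⟨b, rfl⟩; exact h b, fun e α hα => ?_⟩
  have key : ∃ d : C, (d = c e.val.1 ∨ d = c e.val.2) ∧
      ∀ b, α ∈ colorInterval G c b e ↔ d = b := by
    rcases hα.2.lt_or_eq with h1 | rfl
    · exact ⟨c e.val.1, Or.inl rfl, fun b => by simp [colorInterval, hα.1, hα.2, h1, h1.ne]⟩
    · exact ⟨c e.val.2, Or.inr rfl, fun b => one_mem_colorInterval⟩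
  obtain ⟨d, hd, hmem⟩ := key
  refine ⟨(colorPiece G c d, colorInterval G c d e), ⟨⟨d, rfl⟩, ?_, (hmem d).2 rfl⟩, ?_⟩
  · exact mem_colorPiece.2 ⟨hd.imp Eq.symm Eq.symm, rfl⟩
  · rintro ⟨P, I⟩ ⟨⟨b, rfl⟩, hI, hαI⟩
    obtain ⟨-, rfl⟩ := mem_colorPiece.1 hI
    rw [(hmem b).1 hαI]

lemma isVertexDisjoint_range_colorPiece :
    IsVertexDisjoint G (Set.range (colorPiece G c)) := by
  rintro v _ ⟨b, rfl⟩ _ ⟨b', rfl⟩ ⟨e, I⟩ hx ⟨e', I'⟩ hy hv hv'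
  obtain ⟨-, rfl⟩ := mem_colorPiece.1 hx
  obtain ⟨-, rfl⟩ := mem_colorPiece.1 hy
  rw [← (endptIn_colorInterval.1 hv).2, ← (endptIn_colorInterval.1 hv').2]

lemma util_colorPiece (u : Edges G → ℚ) (b : C) [DecidableEq C] :
    util G u (colorPiece G c b) =
      ∑ e : Edges G with c e.val.1 = b ∨ c e.val.2 = b,
        len (colorInterval G c b e) * (u e : ℝ) := by
  classical
  unfold util colorPiece
  rw [Finset.sum_image fun _ _ _ _ h => congrArg Prod.fst h]
  exact Finset.sum_congr (by ext; simp) fun _ _ => rfl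

/-- A colour class is a piece if some vertex `w` of that colour is such that every edge meeting
the colour either has `w` as an endpoint or is different from but shares a vertex of this colour
with an edge having `w` as an endpoint. -/
lemma isPiece_colorPiece {b : C} {w : V} (hw : c w = b)
    (h : ∀ e : Edges G, c e.val.1 = b ∨ c e.val.2 = b →
      (w = e.val.1 ∨ w = e.val.2) ∨
      ∃ f : Edges G, (w = f.val.1 ∨ w = f.val.2) ∧ e ≠ f ∧
        ∃ v, c v = b ∧ (v = e.val.1 ∨ v = e.val.2) ∧ (v = f.val.1 ∨ v = f.val.2)) :
    IsPiece G (colorPiece G c b) := by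
  have hsymm : Std.Symm fun x y : Edges G × Set ℝ =>
      x ∈ colorPiece G c b ∧ y ∈ colorPiece G c b ∧ PieceAdj G x y :=
    ⟨fun x y ⟨hx, hy, hne, v, hv⟩ => ⟨hy, hx, hne.symm, v, hv.symm⟩⟩
  have hub : ∀ x ∈ colorPiece G c b, ∃ y ∈ colorPiece G c b, EndptIn G y.1 y.2 w ∧
      Relation.ReflTransGen
        (fun x y => x ∈ colorPiece G c b ∧ y ∈ colorPiece G c b ∧ PieceAdj G x y) x y := by
    rintro ⟨e, I⟩ hx
    obtain ⟨he, rfl⟩ := mem_colorPiece.1 hx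
    rcases h e he with hwe | ⟨f, hwf, hne, v, hv, hve, hvf⟩
    · exact ⟨_, hx, endptIn_colorInterval.2 ⟨hwe, hw⟩, .refl⟩
    · have hf : (f, colorInterval G c b f) ∈ colorPiece G c b :=
        mem_colorPiece.2 ⟨by rcases hwf with rfl | rfl <;> simp [hw], rfl⟩
      exact ⟨_, hf, endptIn_colorInterval.2 ⟨hwf, hw⟩, .single ⟨hx, hf, hne, v,
        endptIn_colorInterval.2 ⟨hve, hv⟩, endptIn_colorInterval.2 ⟨hvf, hv⟩⟩⟩
  refine ⟨?_, fun x hx y hy => ?_⟩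
  · rintro ⟨e, I⟩ hx
    obtain ⟨-, rfl⟩ := mem_colorPiece.1 hx
    exact ⟨fun α hα => hα.1, ordConnected_colorInterval b e⟩
  · obtain ⟨x', hx', hxw, hxx'⟩ := hub x hx
    obtain ⟨y', hy', hyw, hyy'⟩ := hub y hy
    refine hxx'.trans (Relation.ReflTransGen.trans ?_ (Relation.ReflTransGen.stdSymm.symm _ _ hyy'))
    by_cases hne : x'.1 = y'.1
    · have : x' = y' := Prod.ext hne <| by
        rw [(mem_colorPiece.1 hx').2, (mem_colorPiece.1 hy').2, hne]
      rw [this]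
    · exact .single ⟨hx', hy', hne, w, hxw, hyw⟩

end Coloring

lemma matchPlusTwo_edge_iff {n u v : ℕ} :
    (u < v ∧ (matchPlusTwo n).Adj u v) ↔
      ∃ i, 1 ≤ i ∧ i ≤ n ∧
        ((u = 0 ∧ v = 2 * i) ∨ (u = 1 ∧ v = 2 * i) ∨ (u = 2 * i ∧ v = 2 * i + 1)) := by
  rw [matchPlusTwo, SimpleGraph.fromRel_adj]
  constructor
  · rintro ⟨huv, -, h | ⟨i, hi⟩⟩
    · exact h
    · omega
  · intro h
    have h' := h
    obtain ⟨i, hi⟩ := h'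
    exact ⟨by omega, by omega, Or.inl h⟩

instance finite_edges_matchPlusTwo (n : ℕ) : Finite (Edges (matchPlusTwo n)) := by
  refine Set.Finite.subset ((Set.finite_Iic (2 * n + 1)).prod (Set.finite_Iic (2 * n + 1))) ?_
  rintro ⟨u, v⟩ h
  obtain ⟨i, hi⟩ := matchPlusTwo_edge_iff.1 h
  simp only [Set.mem_prod, Set.mem_Iic]
  omega

/-- The colouring of the vertices of `matchPlusTwo n` induced by a set `T` of indices:
`c₁` and all `lᵢ, l'ᵢ` with `i ∈ T` get colour `0`, all other vertices get colour `1`. -/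
def matchColor (T : Finset ℕ) (v : ℕ) : Fin 2 :=
  if v = 0 then 0 else if v = 1 then 1 else if v / 2 ∈ T then 0 else 1

lemma matchColor_val (T : Finset ℕ) (b : Fin 2) : matchColor T b = b := by
  fin_cases b <;> simp [matchColor]

lemma matchColor_two_mul (T : Finset ℕ) {i : ℕ} (hi : 1 ≤ i) :
    matchColor T (2 * i) = if i ∈ T then 0 else 1 := by
  have h1 : 2 * i ≠ 1 := by omega
  have h0 : i ≠ 0 := by omega
  simp [matchColor, h0, h1]

lemma matchColor_two_mul_add_one (T : Finset ℕ) {i : ℕ} (hi : 1 ≤ i) :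
    matchColor T (2 * i + 1) = if i ∈ T then 0 else 1 := by
  have h1 : (2 * i + 1) / 2 = i := by omega
  have h0 : i ≠ 0 := by omega
  simp [matchColor, h0, h1]

lemma isPiece_matchColor (n : ℕ) [Fintype (Edges (matchPlusTwo n))] (T : Finset ℕ) (b : Fin 2) :
    IsPiece (matchPlusTwo n) (colorPiece (matchPlusTwo n) (matchColor T) b) := by
  refine isPiece_colorPiece (matchColor_val T b) ?_
  rintro ⟨⟨u, v⟩, he⟩ hb
  obtain ⟨i, hi1, hin, h⟩ := matchPlusTwo_edge_iff.1 he
  by_cases hbu : (b : ℕ) = u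
  · exact Or.inl (Or.inl hbu)
  have hcol : matchColor T (2 * i) = b := by
    have h0 := matchColor_val T 0
    have h1 := matchColor_val T 1
    rcases h with ⟨rfl, rfl⟩ | ⟨rfl, rfl⟩ | ⟨rfl, rfl⟩
    · rcases hb with hb | hb
      · exact absurd (by rw [← hb]; simpa using congrArg Fin.val h0) hbu
      · exact hb
    · rcases hb with hb | hb
      · exact absurd (by rw [← hb]; simpa using congrArg Fin.val h1) hbu
      · exact hb
    · rcases hb with hb | hb
      · exact hb
      · rwa [matchColor_two_mul T hi1, ← matchColor_two_mul_add_one T hi1]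
  have hf : (b : ℕ) < 2 * i ∧ (matchPlusTwo n).Adj b (2 * i) :=
    matchPlusTwo_edge_iff.2 ⟨i, hi1, hin, by omega⟩
  refine Or.inr ⟨⟨(b, 2 * i), hf⟩, Or.inl rfl, ?_, 2 * i, hcol, ?_, Or.inr rfl⟩
  · intro heq
    exact hbu (congrArg (fun e => e.val.1) heq).symm
  · dsimp only
    omega

lemma util_matchColor (n : ℕ) [Fintype (Edges (matchPlusTwo n))] (s : ℕ → ℚ) (T : Finset ℕ)
    (b : Fin 2) :
    util (matchPlusTwo n) (matchUtil n s) (colorPiece (matchPlusTwo n) (matchColor T) b) =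
      ∑ i ∈ Finset.Icc 1 n with matchColor T (2 * i) = b, (s i : ℝ) := by
  have hedge : ∀ e : Edges (matchPlusTwo n), 2 ≤ e.val.1 →
      ∃ i, 1 ≤ i ∧ i ≤ n ∧ e.val.1 = 2 * i ∧ e.val.2 = 2 * i + 1 := fun e h2 => by
    obtain ⟨i, hi⟩ := matchPlusTwo_edge_iff.1 e.property
    exact ⟨i, by omega⟩
  rw [util_colorPiece, ← Finset.sum_filter_of_ne (p := fun e => 2 ≤ e.val.1)]
  · refine Finset.sum_nbij (fun e => e.val.1 / 2) ?_ ?_ ?_ ?_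
    · intro e he
      simp only [Finset.mem_filter, Finset.mem_univ, true_and] at he
      obtain ⟨i, hi1, hin, h1, h2⟩ := hedge e he.2
      have hcol := he.1
      rw [h1, h2, matchColor_two_mul_add_one T hi1, ← matchColor_two_mul T hi1, or_self] at hcol
      simp [h1, hi1, hin, hcol]
    · intro e he f hf hef
      simp only [Finset.coe_filter, Finset.mem_filter, Finset.mem_univ, true_and,
        Set.mem_ofPred_eq] at he hf
      obtain ⟨i, hi1, hin, h1, h2⟩ := hedge e he.2
      obtain ⟨j, hj1, hjn, h3, h4⟩ := hedge f hf.2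
      dsimp only at hef
      exact Subtype.ext (Prod.ext (by omega) (by omega))
    · intro i hi
      simp only [Finset.coe_filter, Finset.mem_Icc, Set.mem_ofPred_eq] at hi
      refine ⟨⟨(2 * i, 2 * i + 1), matchPlusTwo_edge_iff.2 ⟨i, by omega⟩⟩, ?_, ?_⟩
      · simp [hi.2, hi.1.1]
      · simp
    · intro e he
      simp only [Finset.mem_filter, Finset.mem_univ, true_and] at he
      obtain ⟨i, hi1, hin, h1, h2⟩ := hedge e he.2
      have hcol := he.1
      rw [h1, h2, matchColor_two_mul_add_one T hi1, ← matchColor_two_mul T hi1, or_self] at hcol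
      rw [colorInterval_eq_Icc (by rw [h1, hcol])
        (by rw [h2, matchColor_two_mul_add_one T hi1, ← matchColor_two_mul T hi1, hcol])]
      simp [len, matchUtil, he.2]
  · intro e _ hne
    by_contra h2
    simp [matchUtil, h2] at hne

/-- if the values `s 1, …, s n` can be partitioned into two parts of equal
sum, then the graph consisting of a matching `lᵢ l'ᵢ` plus two additional vertices `c₁, c₂`
joined to every `lᵢ`, with two agents both valuing edge `lᵢ l'ᵢ` at `s i` and all other
edges at `0`, admits a vertex-disjoint partition into pieces with an envy-free
assignment. -/
theorem stmt1 (n : ℕ) (hn : 1 ≤ n) (s : ℕ → ℚ) (hs : ∀ i ∈ Finset.Icc 1 n, 0 ≤ s i)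
    (T : Finset ℕ) (hT : T ⊆ Finset.Icc 1 n)
    (hsum : ∑ i ∈ T, s i = ∑ i ∈ Finset.Icc 1 n \ T, s i) :
    ∃ (Part : Set (Finset (Edges (matchPlusTwo n) × Set ℝ)))
      (π : Fin 2 → Finset (Edges (matchPlusTwo n) × Set ℝ)),
      IsPartition (matchPlusTwo n) Part ∧
      IsVertexDisjoint (matchPlusTwo n) Part ∧
      IsEFAssignment (matchPlusTwo n) (fun _ => matchUtil n s) Part π := by
  classical
  have := Fintype.ofFinite (Edges (matchPlusTwo n))
  have hutil : ∀ a a' : Fin 2,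
      util (matchPlusTwo n) (matchUtil n s) (colorPiece (matchPlusTwo n) (matchColor T) a) =
        util (matchPlusTwo n) (matchUtil n s)
          (colorPiece (matchPlusTwo n) (matchColor T) a') := by
    have h0 : (Finset.Icc 1 n).filter (fun i => matchColor T (2 * i) = 0) = T := by
      ext i
      rw [Finset.mem_filter]
      constructor
      · rintro ⟨hi, h⟩
        rw [matchColor_two_mul T (Finset.mem_Icc.1 hi).1] at h
        by_contra hiT
        simp [hiT] at h
      · intro hi
        exact ⟨hT hi, by rw [matchColor_two_mul T (Finset.mem_Icc.1 (hT hi)).1, if_pos hi]⟩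
    have h1 : (Finset.Icc 1 n).filter (fun i => matchColor T (2 * i) = 1) =
        Finset.Icc 1 n \ T := by
      conv_rhs => rw [← h0, ← Finset.filter_not]
      exact Finset.filter_congr fun i _ => by omega
    have hsum' : ∑ i ∈ T, (s i : ℝ) = ∑ i ∈ Finset.Icc 1 n \ T, (s i : ℝ) := by
      exact_mod_cast hsum
    intro a a'
    rw [util_matchColor, util_matchColor]
    fin_cases a <;> fin_cases a' <;> simp [h0, h1, hsum']
  refine ⟨Set.range (colorPiece (matchPlusTwo n) (matchColor T)),
    colorPiece (matchPlusTwo n) (matchColor T),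
    isPartition_range_colorPiece (isPiece_matchColor n T),
    isVertexDisjoint_range_colorPiece, ?_, rfl, fun a a' => (hutil a' a).le⟩
  intro a a' h
  let e : Edges (matchPlusTwo n) :=
    ⟨((a : ℕ), 2), matchPlusTwo_edge_iff.2 ⟨1, le_rfl, hn, by omega⟩⟩
  have hmem : (e, colorInterval (matchPlusTwo n) (matchColor T) a e) ∈
      colorPiece (matchPlusTwo n) (matchColor T) a :=
    mem_colorPiece.2 ⟨Or.inl (matchColor_val T a), rfl⟩
  rw [h] at hmem
  have hI := (mem_colorPiece.1 hmem).2
  have h0 : (0 : ℝ) ∈ colorInterval (matchPlusTwo n) (matchColor T) a e :=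
    zero_mem_colorInterval.2 (matchColor_val T a)
  rw [hI] at h0
  exact (matchColor_val T a).symm.trans (zero_mem_colorInterval.1 h0)

end GraphCutting
end

section
/- Let n ≥ 1 and let s : {1,…,n} → ℚ be nonnegative. Let G be the graph with vertices a_i, b_i, c_i, d_i for i = 1,…,n, whose edges are a_i c_i, c_i b_i and c_i d_i for all i ∈ {1,…,n}, together with a_i a_{i+1} and b_i b_{i+1} for all i ∈ {1,…,n−1}. Let there be two agents with identical utilities given by value s(i) on each edge c_i d_i and value 0 on every other edge. If there exists a set T ⊆ {1,…,n} with Σ_{i∈T} s(i) = Σ_{i∉T} s(i), then there exist a vertex-disjoint partition Π of G into pieces and an envy-free assignment of the two agents to Π (in particular, an envy-free assignment exists for both the unrestricted and the vertex-disjoint setting). -/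
namespace GraphCutting

/-- The graph with vertices `aᵢ = 4i`, `bᵢ = 4i+1`, `cᵢ = 4i+2`, `dᵢ = 4i+3`
(for `1 ≤ i ≤ n`), with edges `aᵢ cᵢ`, `cᵢ bᵢ`, `cᵢ dᵢ` for all `1 ≤ i ≤ n` and
`aᵢ aᵢ₊₁`, `bᵢ bᵢ₊₁` for all `1 ≤ i ≤ n-1`. -/
def ladderGadget (n : ℕ) : SimpleGraph ℕ :=
  SimpleGraph.fromRel (fun x y =>
    ∃ i, 1 ≤ i ∧ i ≤ n ∧
      ((x = 4 * i ∧ y = 4 * i + 2) ∨ (x = 4 * i + 1 ∧ y = 4 * i + 2) ∨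
       (x = 4 * i + 2 ∧ y = 4 * i + 3) ∨
       (i + 1 ≤ n ∧ ((x = 4 * i ∧ y = 4 * (i + 1)) ∨ (x = 4 * i + 1 ∧ y = 4 * (i + 1) + 1)))))

/-- Both agents value the edge `cᵢ dᵢ = (4i+2, 4i+3)` at `s i` and every other edge at `0`.
(The edges `cᵢ dᵢ` are precisely those whose smaller endpoint is `≡ 2 (mod 4)`.) -/
def ladderUtil (n : ℕ) (s : ℕ → ℚ) (e : Edges (ladderGadget n)) : ℚ :=
  if e.val.1 % 4 = 2 then s (e.val.1 / 4) else 0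

section Owned

variable {V κ : Type*} [LinearOrder V]

/-- The part of the edge `e` that belongs to the owner `k`, when every vertex has an owner and
every edge without its larger endpoint belongs to the owner of its smaller endpoint. -/
def ownedInterval (G : SimpleGraph V) (own : V → κ) (k : κ) (e : Edges G) : Set ℝ :=
  {α | α ∈ Set.Icc (0 : ℝ) 1 ∧ (if α < 1 then own e.val.1 else own e.val.2) = k}

open Classical in
/-- The collection of all nonempty pieces of edges that belong to the owner `k`. -/
noncomputable def ownedPiece (G : SimpleGraph V) [Fintype (Edges G)] (own : V → κ) (k : κ) :
    Finset (Edges G × Set ℝ) :=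
  (Finset.univ.filter fun e : Edges G => own e.val.1 = k ∨ own e.val.2 = k).image
    fun e => (e, ownedInterval G own k e)

variable {G : SimpleGraph V} {own : V → κ}

lemma ownedInterval_of_both {k : κ} {e : Edges G} (h₁ : own e.val.1 = k) (h₂ : own e.val.2 = k) :
    ownedInterval G own k e = Set.Icc 0 1 := by
  ext α
  simp [ownedInterval, h₁, h₂]

lemma ownedInterval_of_left {k : κ} {e : Edges G} (h₁ : own e.val.1 = k) (h₂ : own e.val.2 ≠ k) :
    ownedInterval G own k e = Set.Ico 0 1 := by
  ext α
  by_cases h : α < 1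
  · simp [ownedInterval, h₁, h, h.le]
  · simp [ownedInterval, h₂, h]

lemma ownedInterval_of_right {k : κ} {e : Edges G} (h₁ : own e.val.1 ≠ k)
    (h₂ : own e.val.2 = k) : ownedInterval G own k e = Set.Icc 1 1 := by
  ext α
  by_cases h : α < 1
  · simp [ownedInterval, h₁, h, h.ne]
  · simp only [ownedInterval, h, if_false, h₂, and_true, Set.mem_ofPred_eq, Set.mem_Icc]
    constructor <;> rintro ⟨h₃, h₄⟩ <;> constructor <;> linarith

lemma ownedInterval_of_neither {k : κ} {e : Edges G} (h₁ : own e.val.1 ≠ k)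
    (h₂ : own e.val.2 ≠ k) : ownedInterval G own k e = ∅ := by
  ext α
  by_cases h : α < 1 <;> simp [ownedInterval, h₁, h₂, h]

lemma ordConnected_ownedInterval (k : κ) (e : Edges G) :
    (ownedInterval G own k e).OrdConnected := by
  by_cases h₁ : own e.val.1 = k <;> by_cases h₂ : own e.val.2 = k
  · rw [ownedInterval_of_both h₁ h₂]; exact Set.ordConnected_Icc
  · rw [ownedInterval_of_left h₁ h₂]; exact Set.ordConnected_Ico
  · rw [ownedInterval_of_right h₁ h₂]; exact Set.ordConnected_Icc
  · rw [ownedInterval_of_neither h₁ h₂]; exact Set.ordConnected_empty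

lemma len_ownedInterval [DecidableEq κ] (k : κ) (e : Edges G) :
    len (ownedInterval G own k e) = if own e.val.1 = k then 1 else 0 := by
  by_cases h₁ : own e.val.1 = k <;> by_cases h₂ : own e.val.2 = k
  · simp [ownedInterval_of_both h₁ h₂, len, h₁]
  · simp [ownedInterval_of_left h₁ h₂, len, h₁]
  · simp [ownedInterval_of_right h₁ h₂, len, h₁]
  · simp [ownedInterval_of_neither h₁ h₂, len, h₁]

lemma endptIn_ownedInterval_iff {k : κ} {e : Edges G} {v : V} :
    EndptIn G e (ownedInterval G own k e) v ↔ (v = e.val.1 ∨ v = e.val.2) ∧ own v = k := by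
  unfold EndptIn ownedInterval
  constructor
  · rintro (⟨rfl, h⟩ | ⟨rfl, h⟩)
    · exact ⟨Or.inl rfl, by simpa using h⟩
    · exact ⟨Or.inr rfl, by simpa using h⟩
  · rintro ⟨rfl | rfl, rfl⟩ <;> simp

lemma PieceAdj.symm {x y : Edges G × Set ℝ} (h : PieceAdj G x y) : PieceAdj G y x :=
  ⟨h.1.symm, h.2.imp fun _ hv => hv.symm⟩

variable [Fintype (Edges G)]

lemma mem_ownedPiece {k : κ} {x : Edges G × Set ℝ} :
    x ∈ ownedPiece G own k ↔
      (own x.1.val.1 = k ∨ own x.1.val.2 = k) ∧ x.2 = ownedInterval G own k x.1 := by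
  obtain ⟨e, I⟩ := x
  simp only [ownedPiece, Finset.mem_image, Finset.mem_filter, Finset.mem_univ, true_and,
    Prod.mk.injEq]
  constructor
  · rintro ⟨e, h, rfl, rfl⟩
    exact ⟨h, rfl⟩
  · rintro ⟨h, rfl⟩
    exact ⟨e, h, rfl, rfl⟩

/-- The parts of two edges that belong to `k` are linked within the piece of `k`. -/
def OwnedLinked (own : V → κ) (k : κ) (e f : Edges G) : Prop :=
  Relation.ReflTransGen
    (fun a b => a ∈ ownedPiece G own k ∧ b ∈ ownedPiece G own k ∧ PieceAdj G a b)
    (e, ownedInterval G own k e) (f, ownedInterval G own k f)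

lemma OwnedLinked.symm {k : κ} {e f : Edges G} (h : OwnedLinked own k e f) :
    OwnedLinked own k f e := by
  have : Std.Symm (fun a b : Edges G × Set ℝ =>
      a ∈ ownedPiece G own k ∧ b ∈ ownedPiece G own k ∧ PieceAdj G a b) :=
    ⟨fun _ _ hab => ⟨hab.2.1, hab.1, hab.2.2.symm⟩⟩
  exact Relation.ReflTransGen.stdSymm.symm _ _ h

lemma OwnedLinked.trans {k : κ} {e f g : Edges G} (h : OwnedLinked own k e f)
    (h' : OwnedLinked own k f g) : OwnedLinked own k e g :=
  Relation.ReflTransGen.trans h h'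

lemma ownedLinked_of_common_vertex {k : κ} {e f : Edges G} (v : V) (hv : own v = k)
    (he : v = e.val.1 ∨ v = e.val.2) (hf : v = f.val.1 ∨ v = f.val.2) :
    OwnedLinked own k e f := by
  by_cases hef : e = f
  · subst hef
    exact Relation.ReflTransGen.refl
  · refine Relation.ReflTransGen.single ⟨mem_ownedPiece.2 ⟨?_, rfl⟩, mem_ownedPiece.2 ⟨?_, rfl⟩,
      hef, v, endptIn_ownedInterval_iff.2 ⟨he, hv⟩, endptIn_ownedInterval_iff.2 ⟨hf, hv⟩⟩
    · rcases he with rfl | rfl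
      exacts [Or.inl hv, Or.inr hv]
    · rcases hf with rfl | rfl
      exacts [Or.inl hv, Or.inr hv]

lemma isPiece_ownedPiece (k : κ) (e₀ : Edges G)
    (h : ∀ e : Edges G, (own e.val.1 = k ∨ own e.val.2 = k) → OwnedLinked own k e e₀) :
    IsPiece G (ownedPiece G own k) := by
  constructor
  · intro x hx
    rw [(mem_ownedPiece.1 hx).2]
    exact ⟨fun α hα => hα.1, ordConnected_ownedInterval _ _⟩
  · rintro ⟨e, I⟩ hx ⟨f, J⟩ hy
    obtain ⟨he, hI⟩ := mem_ownedPiece.1 hx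
    obtain ⟨hf, hJ⟩ := mem_ownedPiece.1 hy
    dsimp only at he hf hI hJ
    subst hI hJ
    exact (h e he).trans (h f hf).symm

lemma isPartition_range_ownedPiece (h : ∀ k, IsPiece G (ownedPiece G own k)) :
    IsPartition G (Set.range (ownedPiece G own)) := by
  refine ⟨by rintro _ ⟨k, rfl⟩; exact h k, fun e α hα => ?_⟩
  obtain ⟨k, hk⟩ : ∃ k, (if α < 1 then own e.val.1 else own e.val.2) = k := ⟨_, rfl⟩
  refine ⟨(ownedPiece G own k, ownedInterval G own k e),
    ⟨⟨k, rfl⟩, mem_ownedPiece.2 ⟨?_, rfl⟩, hα, hk⟩, ?_⟩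
  · split_ifs at hk
    exacts [Or.inl hk, Or.inr hk]
  · rintro ⟨P, I⟩ ⟨⟨l, rfl⟩, hI, hαI⟩
    obtain ⟨-, hI⟩ := mem_ownedPiece.1 hI
    dsimp only at hI hαI
    subst hI
    obtain rfl : k = l := hk.symm.trans hαI.2
    rfl

lemma isVertexDisjoint_range_ownedPiece :
    IsVertexDisjoint G (Set.range (ownedPiece G own)) := by
  rintro v _ ⟨k, rfl⟩ _ ⟨l, rfl⟩ ⟨e, I⟩ hx ⟨f, J⟩ hy hex hey
  obtain ⟨-, hI⟩ := mem_ownedPiece.1 hx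
  obtain ⟨-, hJ⟩ := mem_ownedPiece.1 hy
  dsimp only at hI hJ hex hey
  subst hI hJ
  rw [← (endptIn_ownedInterval_iff.1 hex).2, ← (endptIn_ownedInterval_iff.1 hey).2]

lemma ownedPiece_injective (h : ∀ k, ∃ e : Edges G, own e.val.1 = k) :
    Function.Injective (ownedPiece G own) := by
  intro k l hkl
  obtain ⟨e, he⟩ := h k
  have hmem : (e, ownedInterval G own k e) ∈ ownedPiece G own l :=
    hkl ▸ mem_ownedPiece.2 ⟨Or.inl he, rfl⟩
  have h0 : (0 : ℝ) ∈ ownedInterval G own k e := by simp [ownedInterval, he]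
  have heq : ownedInterval G own k e = ownedInterval G own l e := (mem_ownedPiece.1 hmem).2
  rw [heq] at h0
  simpa [ownedInterval, he] using h0

lemma util_ownedPiece [DecidableEq κ] (u : Edges G → ℚ) (k : κ) :
    util G u (ownedPiece G own k) =
      ∑ e ∈ Finset.univ.filter (fun e : Edges G => own e.val.1 = k), (u e : ℝ) := by
  classical
  unfold util ownedPiece
  rw [Finset.sum_image fun e _ f _ h => (Prod.mk.inj h).1]
  simp only [len_ownedInterval, ite_mul, one_mul, zero_mul]
  rw [← Finset.sum_filter]
  refine Finset.sum_congr ?_ fun _ _ => rfl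
  ext e
  simp only [Finset.mem_filter, Finset.mem_univ, true_and]
  tauto

end Owned

section Ladder

variable {n : ℕ}

instance : Finite (Edges (ladderGadget n)) := by
  refine Set.Finite.subset ((Set.finite_Iic (4 * n + 3)).prod (Set.finite_Iic (4 * n + 3))) ?_
  rintro ⟨x, y⟩ ⟨-, -, ⟨i, -, hi, h⟩ | ⟨i, -, hi, h⟩⟩ <;>
    simp only [Set.mem_prod, Set.mem_Iic] <;> omega

noncomputable instance : Fintype (Edges (ladderGadget n)) := Fintype.ofFinite _

/-- The edge from `aᵢ` (for `k = 0`) or `bᵢ` (for `k = 1`) to `cᵢ`. -/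
def spoke (k : Fin 2) (i : ℕ) (h : 1 ≤ i ∧ i ≤ n) : Edges (ladderGadget n) :=
  ⟨(4 * i + k, 4 * i + 2), by
    have := k.isLt
    refine ⟨by dsimp only; omega, by dsimp only; omega, Or.inl ⟨i, h.1, h.2, ?_⟩⟩
    dsimp only
    omega⟩

/-- The edge from `aᵢ` to `aᵢ₊₁` (for `k = 0`) or from `bᵢ` to `bᵢ₊₁` (for `k = 1`). -/
def rail (k : Fin 2) (i : ℕ) (h : 1 ≤ i ∧ i + 1 ≤ n) : Edges (ladderGadget n) :=
  ⟨(4 * i + k, 4 * (i + 1) + k), by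
    have := k.isLt
    refine ⟨by dsimp only; omega, by dsimp only; omega, Or.inl ⟨i, h.1, by omega, ?_⟩⟩
    dsimp only
    omega⟩

/-- The edge from `cᵢ` to `dᵢ`. -/
def pendant (i : ℕ) (h : 1 ≤ i ∧ i ≤ n) : Edges (ladderGadget n) :=
  ⟨(4 * i + 2, 4 * i + 3), by
    refine ⟨by dsimp only; omega, by dsimp only; omega, Or.inl ⟨i, h.1, h.2, ?_⟩⟩
    dsimp only
    omega⟩

lemma ladder_edge_cases (e : Edges (ladderGadget n)) :
    (∃ k i h, e = spoke k i h) ∨ (∃ k i h, e = rail k i h) ∨ ∃ i h, e = pendant i h := by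
  obtain ⟨⟨x, y⟩, hxy, -, ⟨i, hi, hn, h⟩ | ⟨i, hi, hn, h⟩⟩ := e
  · dsimp only at hxy h
    rcases h with ⟨rfl, rfl⟩ | ⟨rfl, rfl⟩ | ⟨rfl, rfl⟩ | ⟨hn', ⟨rfl, rfl⟩ | ⟨rfl, rfl⟩⟩
    · exact Or.inl ⟨0, i, ⟨hi, hn⟩, rfl⟩
    · exact Or.inl ⟨1, i, ⟨hi, hn⟩, rfl⟩
    · exact Or.inr (Or.inr ⟨i, ⟨hi, hn⟩, rfl⟩)
    · exact Or.inr (Or.inl ⟨0, i, ⟨hi, hn'⟩, rfl⟩)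
    · exact Or.inr (Or.inl ⟨1, i, ⟨hi, hn'⟩, rfl⟩)
  · dsimp only at hxy h
    omega

/-- All `aᵢ` belong to `0` and all `bᵢ` to `1`; `cᵢ` and `dᵢ` belong to `0` if `i ∈ T` and to `1`
otherwise. -/
def ladderOwner (T : Finset ℕ) (v : ℕ) : Fin 2 :=
  if v % 4 = 0 then 0 else if v % 4 = 1 then 1 else if v / 4 ∈ T then 0 else 1

variable (T : Finset ℕ)

lemma ladderOwner_side (k : Fin 2) (i : ℕ) : ladderOwner T (4 * i + k) = k := by
  fin_cases k <;> simp [ladderOwner]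

lemma ladderOwner_center (i : ℕ) : ladderOwner T (4 * i + 2) = if i ∈ T then 0 else 1 := by
  have h₁ : (4 * i + 2) % 4 = 2 := by omega
  have h₂ : (4 * i + 2) / 4 = i := by omega
  simp [ladderOwner, h₁, h₂]

lemma ladderOwner_leaf (i : ℕ) : ladderOwner T (4 * i + 3) = ladderOwner T (4 * i + 2) := by
  have h₁ : (4 * i + 3) % 4 = 3 := by omega
  have h₂ : (4 * i + 3) / 4 = i := by omega
  rw [ladderOwner_center]
  simp [ladderOwner, h₁, h₂]

lemma ownedLinked_spoke_spoke_one (k : Fin 2) (hn : 1 ≤ n) (i : ℕ) (h : 1 ≤ i ∧ i ≤ n) :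
    OwnedLinked (ladderOwner T) k (spoke k i h) (spoke k 1 ⟨le_rfl, hn⟩) := by
  obtain ⟨h₁, h₂⟩ := h
  induction i, h₁ using Nat.le_induction with
  | base => exact Relation.ReflTransGen.refl
  | succ i hi ih =>
    have hr : 1 ≤ i ∧ i + 1 ≤ n := ⟨hi, h₂⟩
    have upper : OwnedLinked (ladderOwner T) k (spoke k (i + 1) ⟨by omega, h₂⟩) (rail k i hr) :=
      ownedLinked_of_common_vertex _ (ladderOwner_side T k (i + 1)) (Or.inl rfl) (Or.inr rfl)
    have lower : OwnedLinked (ladderOwner T) k (rail k i hr) (spoke k i ⟨hi, by omega⟩) :=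
      ownedLinked_of_common_vertex _ (ladderOwner_side T k i) (Or.inl rfl) (Or.inl rfl)
    exact (upper.trans lower).trans (ih (by omega))

lemma isPiece_ladder (hn : 1 ≤ n) (k : Fin 2) :
    IsPiece (ladderGadget n) (ownedPiece (ladderGadget n) (ladderOwner T) k) := by
  refine isPiece_ownedPiece k (spoke k 1 ⟨le_rfl, hn⟩) fun e he => ?_
  rcases ladder_edge_cases e with ⟨l, i, h, rfl⟩ | ⟨l, i, h, rfl⟩ | ⟨i, h, rfl⟩
  · refine OwnedLinked.trans ?_ (ownedLinked_spoke_spoke_one T k hn i h)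
    rcases he with he | he
    · obtain rfl : l = k := (ladderOwner_side T l i).symm.trans he
      exact Relation.ReflTransGen.refl
    · exact ownedLinked_of_common_vertex _ he (Or.inr rfl) (Or.inr rfl)
  · obtain rfl : l = k := by
      rcases he with he | he
      exacts [(ladderOwner_side T l i).symm.trans he,
        (ladderOwner_side T l (i + 1)).symm.trans he]
    have hi : 1 ≤ i ∧ i ≤ n := ⟨h.1, by omega⟩
    exact (ownedLinked_of_common_vertex (f := spoke l i hi) _ (ladderOwner_side T l i)
      (Or.inl rfl) (Or.inl rfl)).trans (ownedLinked_spoke_spoke_one T l hn i hi)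
  · have hc : ladderOwner T (4 * i + 2) = k := by
      rcases he with he | he
      exacts [he, (ladderOwner_leaf T i).symm.trans he]
    exact (ownedLinked_of_common_vertex (f := spoke k i h) _ hc (Or.inl rfl) (Or.inr rfl)).trans
      (ownedLinked_spoke_spoke_one T k hn i h)

lemma util_ladder (s : ℕ → ℚ) (k : Fin 2) :
    util (ladderGadget n) (ladderUtil n s) (ownedPiece (ladderGadget n) (ladderOwner T) k) =
      ∑ i ∈ (Finset.Icc 1 n).filter (fun i => (if i ∈ T then 0 else 1) = k), (s i : ℝ) := by
  rw [util_ownedPiece]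
  symm
  refine Finset.sum_bij_ne_zero
    (fun i hi _ => pendant i (by simpa using (Finset.mem_filter.1 hi).1)) ?_ ?_ ?_ ?_
  · intro i hi _
    simpa [pendant, ladderOwner_center] using (Finset.mem_filter.1 hi).2
  · intro i _ _ j _ _ hij
    simpa [pendant] using hij
  · intro e he hne
    have he' := (Finset.mem_filter.1 he).2
    rcases ladder_edge_cases e with ⟨l, i, h, rfl⟩ | ⟨l, i, h, rfl⟩ | ⟨i, h, rfl⟩
    · refine absurd ?_ hne
      have : ¬ (l : ℕ) % 4 = 2 := by omega
      simp [ladderUtil, spoke, this]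
    · refine absurd ?_ hne
      have : ¬ (l : ℕ) % 4 = 2 := by omega
      simp [ladderUtil, rail, this]
    · refine ⟨i, ?_, ?_, rfl⟩
      · exact Finset.mem_filter.2 ⟨Finset.mem_Icc.2 h, (ladderOwner_center T i).symm.trans he'⟩
      · have h₁ : (4 * i + 2) % 4 = 2 := by omega
        have h₂ : (4 * i + 2) / 4 = i := by omega
        simpa [ladderUtil, pendant, h₁, h₂] using hne
  · intro i _ _
    have h₁ : (4 * i + 2) % 4 = 2 := by omega
    have h₂ : (4 * i + 2) / 4 = i := by omega
    simp [ladderUtil, pendant, h₁, h₂]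

end Ladder

/-- if the values `s 1, …, s n` can be partitioned into two parts of equal
sum, then the gadget graph with the two agents' common utility placing value `s i` on each
edge `cᵢ dᵢ` and `0` elsewhere admits a vertex-disjoint partition into pieces with an
envy-free assignment (in particular an envy-free assignment exists in both the
unrestricted and the vertex-disjoint setting). -/
theorem stmt2 (n : ℕ) (hn : 1 ≤ n) (s : ℕ → ℚ) (hs : ∀ i ∈ Finset.Icc 1 n, 0 ≤ s i)
    (T : Finset ℕ) (hT : T ⊆ Finset.Icc 1 n)
    (hsum : ∑ i ∈ T, s i = ∑ i ∈ Finset.Icc 1 n \ T, s i) :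
    ∃ (Part : Set (Finset (Edges (ladderGadget n) × Set ℝ)))
      (π : Fin 2 → Finset (Edges (ladderGadget n) × Set ℝ)),
      IsPartition (ladderGadget n) Part ∧
      IsVertexDisjoint (ladderGadget n) Part ∧
      IsEFAssignment (ladderGadget n) (fun _ => ladderUtil n s) Part π := by
  have hutil : ∀ k l : Fin 2,
      util (ladderGadget n) (ladderUtil n s) (ownedPiece (ladderGadget n) (ladderOwner T) k) =
        util (ladderGadget n) (ladderUtil n s) (ownedPiece (ladderGadget n) (ladderOwner T) l) := by
    have h₀ : (Finset.Icc 1 n).filter (fun i => (if i ∈ T then 0 else 1) = (0 : Fin 2)) = T := by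
      ext i
      by_cases hi : i ∈ T
      · simpa [hi] using hT hi
      · simp [hi]
    have h₁ : (Finset.Icc 1 n).filter (fun i => (if i ∈ T then 0 else 1) = (1 : Fin 2)) =
        Finset.Icc 1 n \ T := by
      ext i
      by_cases hi : i ∈ T <;> simp [hi]
    have h : (∑ i ∈ T, (s i : ℝ)) = ∑ i ∈ Finset.Icc 1 n \ T, (s i : ℝ) := by
      exact_mod_cast hsum
    have hside : ∀ k : Fin 2,
        util (ladderGadget n) (ladderUtil n s) (ownedPiece (ladderGadget n) (ladderOwner T) k) =
          ∑ i ∈ T, (s i : ℝ) := by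
      refine Fin.forall_fin_two.2 ⟨?_, ?_⟩
      · rw [util_ladder, h₀]
      · rw [util_ladder, h₁, h]
    intro k l
    rw [hside, hside]
  exact ⟨_, ownedPiece (ladderGadget n) (ladderOwner T),
    isPartition_range_ownedPiece (isPiece_ladder T hn), isVertexDisjoint_range_ownedPiece,
    ownedPiece_injective fun k => ⟨spoke k 1 ⟨le_rfl, hn⟩, ladderOwner_side T k 1⟩, rfl,
    fun a a' => (hutil a' a).le⟩

end GraphCutting
end

section
/- Let G be a finite simple graph and Π a partition of G into pieces. Then for every edge e of G, at most two members P ∈ Π contain both a nonempty piece of the edge e and a nonempty piece of some edge different from e; moreover, every such member P contains a piece (e,I) whose interval I contains the endpoint 0 or the endpoint 1 of e. -/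
namespace GraphCutting

/-- In a piece of the graph, a piece of `e` that is accompanied by a piece of another edge
has an interval containing one of the endpoints of `e`. -/
theorem IsPiece.zero_mem_or_one_mem {V : Type*} [LinearOrder V] {G : SimpleGraph V}
    {P : Finset (Edges G × Set ℝ)} (hP : IsPiece G P) {e f : Edges G} {I J : Set ℝ}
    (hI : (e, I) ∈ P) (hJ : (f, J) ∈ P) (hfe : f ≠ e) : (0 : ℝ) ∈ I ∨ (1 : ℝ) ∈ I := by
  rcases (hP.2 _ hI _ hJ).cases_head with h | ⟨c, ⟨-, -, -, v, hv, -⟩, -⟩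
  · exact absurd (congrArg Prod.fst h).symm hfe
  · exact hv.imp And.right And.right

/-- in a partition of `G` into pieces, for every edge `e` at most two
members contain both a nonempty piece of `e` and a nonempty piece of another edge;
moreover each such member contains a piece `(e, I)` with `0 ∈ I` or `1 ∈ I`. -/
theorem stmt10 {V : Type*} [Fintype V] [LinearOrder V] (G : SimpleGraph V)
    (Part : Set (Finset (Edges G × Set ℝ))) (hPart : IsPartition G Part)
    (e : Edges G) :
    Set.encard {P | P ∈ Part ∧ (∃ I, (e, I) ∈ P ∧ I.Nonempty) ∧
        (∃ f J, (f, J) ∈ P ∧ f ≠ e ∧ J.Nonempty)} ≤ 2 ∧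
    ∀ P ∈ Part, (∃ I, (e, I) ∈ P ∧ I.Nonempty) →
      (∃ f J, (f, J) ∈ P ∧ f ≠ e ∧ J.Nonempty) →
      ∃ I, (e, I) ∈ P ∧ ((0 : ℝ) ∈ I ∨ (1 : ℝ) ∈ I) := by
  have key : ∀ P ∈ Part, (∃ I, (e, I) ∈ P ∧ I.Nonempty) →
      (∃ f J, (f, J) ∈ P ∧ f ≠ e ∧ J.Nonempty) →
      ∃ I, (e, I) ∈ P ∧ ((0 : ℝ) ∈ I ∨ (1 : ℝ) ∈ I) := by
    rintro P hP ⟨I, hI, -⟩ ⟨f, J, hJ, hfe, -⟩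
    exact ⟨I, hI, (hPart.1 P hP).zero_mem_or_one_mem hI hJ hfe⟩
  refine ⟨?_, key⟩
  obtain ⟨⟨P₀, I₀⟩, -, h₀⟩ := hPart.2 e 0 (by simp)
  obtain ⟨⟨P₁, I₁⟩, -, h₁⟩ := hPart.2 e 1 (by simp)
  refine (Set.encard_le_encard (t := {P₀, P₁}) ?_).trans ?_
  swap
  · exact (Set.encard_insert_le _ _).trans (by rw [Set.encard_singleton, one_add_one_eq_two])
  rintro P ⟨hP, hPe, hPf⟩
  obtain ⟨I, hI, h | h⟩ := key P hP hPe hPf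
  · exact Or.inl (congrArg Prod.fst (h₀ (P, I) ⟨hP, hI, h⟩))
  · exact Or.inr (congrArg Prod.fst (h₁ (P, I) ⟨hP, hI, h⟩))

end GraphCutting
end

section
/- Let G be a finite tree, A a finite nonempty set of agents with normalized utilities, Π a vertex-disjoint partition of G into pieces, and π : A → Π an envy-free assignment. Then there exists a set F of edges of G with |F| ≤ |A| − 1 such that for every connected component C of the graph G − F (obtained from G by deleting the edges of F) there is a single agent a ∈ A such that every edge e of C is entirely contained in π(a), i.e., for every α ∈ [0,1] the unique member of Π containing the point α of e is π(a). -/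
namespace GraphCutting

/-- Deleting `k` edges from a finite acyclic graph creates at least `k` new components. -/
theorem card_connectedComponent_add_card_le {V : Type*} [Finite V] {G : SimpleGraph V}
    (hG : G.IsAcyclic) (F : Finset (Sym2 V)) (hF : ∀ e ∈ F, e ∈ G.edgeSet) :
    Nat.card G.ConnectedComponent + F.card ≤
      Nat.card (G.deleteEdges (F : Set (Sym2 V))).ConnectedComponent := by
  classical
  induction F using Finset.induction_on with
  | empty => simp
  | insert e F he ih =>
    have ih := ih fun f hf => hF f (Finset.mem_insert_of_mem hf)
    have heG := hF e (Finset.mem_insert_self e F)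
    set G' := G.deleteEdges (F : Set (Sym2 V)) with hG'
    have hdel : G.deleteEdges ((insert e F : Finset (Sym2 V)) : Set (Sym2 V)) =
        G'.deleteEdges {e} := by
      rw [hG', SimpleGraph.deleteEdges_deleteEdges, Finset.coe_insert, Set.insert_eq,
        Set.union_comm]
    have heG' : e ∈ G'.edgeSet := by
      rw [hG', SimpleGraph.edgeSet_deleteEdges]
      exact ⟨heG, by simpa using he⟩
    have hbridge : G'.IsBridge e :=
      SimpleGraph.isAcyclic_iff_forall_isBridge.mp (hG.anti (SimpleGraph.deleteEdges_le _)) heG'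
    have hle : G'.deleteEdges {e} ≤ G' := SimpleGraph.deleteEdges_le _
    have hlt : Nat.card G'.ConnectedComponent <
        Nat.card (G'.deleteEdges {e}).ConnectedComponent := by
      have hsurj := SimpleGraph.ConnectedComponent.surjective_map_ofLE hle
      refine lt_of_le_of_ne (Nat.card_le_card_of_surjective _ hsurj) fun hcard => ?_
      have hinj := ((Nat.bijective_iff_surjective_and_card _).mpr ⟨hsurj, hcard.symm⟩).injective
      induction e using Sym2.ind with
      | _ a b =>
        refine SimpleGraph.isBridge_iff.mp hbridge (SimpleGraph.ConnectedComponent.exact ?_)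
        apply hinj
        exact SimpleGraph.ConnectedComponent.sound
          (SimpleGraph.Adj.reachable ((SimpleGraph.mem_edgeSet G').mp heG'))
    rw [hdel, Finset.card_insert_of_notMem he]
    omega

/-- If the endpoints of every edge that `P` covers at both ends are joined in `H`, then all
vertices covered by the piece `P` are joined in `H`. -/
theorem IsPiece.reachable {V : Type*} [LinearOrder V] {G : SimpleGraph V}
    {P : Finset (Edges G × Set ℝ)} (hP : IsPiece G P)
    {H : SimpleGraph V}
    (hH : ∀ x ∈ P, (0 : ℝ) ∈ x.2 → (1 : ℝ) ∈ x.2 → H.Adj x.1.val.1 x.1.val.2)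
    {x y : Edges G × Set ℝ} (hx : x ∈ P) (hy : y ∈ P) {v w : V}
    (hv : EndptIn G x.1 x.2 v) (hw : EndptIn G y.1 y.2 w) : H.Reachable v w := by
  have key : ∀ z ∈ P, ∀ v w, EndptIn G z.1 z.2 v → EndptIn G z.1 z.2 w →
      H.Reachable v w := by
    rintro z hz v w (⟨rfl, h⟩ | ⟨rfl, h⟩) (⟨rfl, h'⟩ | ⟨rfl, h'⟩)
    · exact .rfl
    · exact (hH z hz h h').reachable
    · exact (hH z hz h' h).symm.reachable
    · exact .rfl
  induction hP.2 x hx y hy generalizing w with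
  | refl => exact key x hx v w hv hw
  | tail _ hstep ih =>
    obtain ⟨hb, hc, -, t, htb, htc⟩ := hstep
    exact (ih hb htb).trans (key _ hc t w htc hw)

theorem Edges.ext_of_sym2_eq {V : Type*} [LinearOrder V] {G : SimpleGraph V} {e f : Edges G}
    (h : s(e.val.1, e.val.2) = s(f.val.1, f.val.2)) : e = f := by
  rcases Sym2.eq_iff.mp h with h | h
  · exact Subtype.ext (Prod.ext h.1 h.2)
  · have h₁ := e.prop.1
    have h₂ := f.prop.1
    rw [h.1, h.2] at h₁
    exact absurd h₁ h₂.not_gt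

/-- In an acyclic graph, a member of a partition covering both ends of an edge covers the
whole edge. -/
theorem IsPartition.eq_of_mem_of_mem {V : Type*} [LinearOrder V] {G : SimpleGraph V}
    (hacyc : G.IsAcyclic)
    {Part : Set (Finset (Edges G × Set ℝ))} (hPart : IsPartition G Part)
    {P Q : Finset (Edges G × Set ℝ)} (hP : P ∈ Part) (hQ : Q ∈ Part) {e : Edges G}
    {I₀ I₁ J : Set ℝ} (h₀ : (e, I₀) ∈ P) (h₁ : (e, I₁) ∈ P) (hI₀ : (0 : ℝ) ∈ I₀)
    (hI₁ : (1 : ℝ) ∈ I₁) {α : ℝ} (hα : α ∈ Set.Icc (0 : ℝ) 1) (hJ : (e, J) ∈ Q)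
    (hαJ : α ∈ J) : Q = P := by
  have hI : I₀ = I₁ := by
    by_contra hne
    have hbridge := SimpleGraph.isAcyclic_iff_forall_adj_isBridge.mp hacyc e.prop.2
    refine SimpleGraph.isBridge_iff.mp hbridge ((hPart.1 P hP).reachable ?_ h₀ h₁
      (Or.inl ⟨rfl, hI₀⟩) (Or.inr ⟨rfl, hI₁⟩))
    rintro ⟨f, I⟩ hf hf₀ hf₁
    refine SimpleGraph.deleteEdges_adj.mpr ⟨f.prop.2, fun hfe => hne ?_⟩
    obtain rfl : f = e := Edges.ext_of_sym2_eq hfe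
    have h₀' := (hPart.2 f 0 (by simp)).unique (y₁ := (P, I₀)) (y₂ := (P, I))
      ⟨hP, h₀, hI₀⟩ ⟨hP, hf, hf₀⟩
    have h₁' := (hPart.2 f 1 (by simp)).unique (y₁ := (P, I₁)) (y₂ := (P, I))
      ⟨hP, h₁, hI₁⟩ ⟨hP, hf, hf₁⟩
    exact (Prod.mk.inj h₀').2.trans (Prod.mk.inj h₁').2.symm
  subst hI
  have hαI : α ∈ I₀ := ((hPart.1 P hP).1 _ h₀).2.out hI₀ hI₁ hα
  exact congrArg Prod.fst ((hPart.2 e α hα).unique (y₁ := (Q, J)) (y₂ := (P, I₀))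
    ⟨hQ, hJ, hαJ⟩ ⟨hP, h₀, hαI⟩)

/-- for a finite tree `G`, a vertex-disjoint partition into pieces and an
envy-free assignment `π`, there is a set `F` of at most `|A| - 1` edges such that every
connected component of `G - F` is entirely contained in the piece `π a` of a single
agent `a`. -/
theorem stmt12 {V : Type*} [Fintype V] [LinearOrder V]
    (G : SimpleGraph V) [DecidableRel G.Adj]
    (hconn : G.Connected) (hacyc : G.IsAcyclic)
    {A : Type*} [Fintype A] [Nonempty A]
    (u : A → Edges G → ℚ) (hnonneg : ∀ a e, 0 ≤ u a e)
    (hnorm : ∀ a, ∑ e : Edges G, u a e = 1)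
    (Part : Set (Finset (Edges G × Set ℝ))) (π : A → Finset (Edges G × Set ℝ))
    (hPart : IsPartition G Part) (hVD : IsVertexDisjoint G Part)
    (hEF : IsEFAssignment G u Part π) :
    ∃ F : Finset (Edges G), F.card + 1 ≤ Fintype.card A ∧
      ∀ C : (G.deleteEdges {p | ∃ f ∈ F, p = s(f.val.1, f.val.2)}).ConnectedComponent,
        ∃ a : A, ∀ e : Edges G, e ∉ F →
          (G.deleteEdges {p | ∃ f ∈ F, p = s(f.val.1, f.val.2)}).connectedComponentMk
              e.val.1 = C →
          ∀ α ∈ Set.Icc (0 : ℝ) 1, ∀ P ∈ Part, ∀ I : Set ℝ,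
            (e, I) ∈ P → α ∈ I → P = π a := by
  classical
  obtain ⟨hinj, rfl, -⟩ := hEF
  have hedge : Nonempty (Edges G) := by
    by_contra hempty
    rw [not_nonempty_iff] at hempty
    simpa using hnorm (Classical.arbitrary A)
  have hV : Nontrivial V := by
    obtain ⟨e⟩ := hedge
    exact ⟨_, _, e.prop.1.ne⟩
  have hcover : ∀ (e : Edges G), ∀ α ∈ Set.Icc (0 : ℝ) 1, ∃ a I, (e, I) ∈ π a ∧ α ∈ I := by
    intro e α hα
    obtain ⟨⟨P, I⟩, ⟨⟨a, ha⟩, hI, hαI⟩, -⟩ := hPart.2 e α hα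
    exact ⟨a, I, by rw [ha]; exact hI, hαI⟩
  have hown : ∀ v : V, ∃ a, ∃ x ∈ π a, EndptIn G x.1 x.2 v := by
    intro v
    obtain ⟨w, hvw⟩ := hconn.preconnected.exists_adj_of_nontrivial v
    rcases lt_or_gt_of_ne hvw.ne with hlt | hlt
    · obtain ⟨a, I, hI, h0⟩ := hcover ⟨(v, w), hlt, hvw⟩ 0 (by simp)
      exact ⟨a, _, hI, Or.inl ⟨rfl, h0⟩⟩
    · obtain ⟨a, I, hI, h1⟩ := hcover ⟨(w, v), hlt, hvw.symm⟩ 1 (by simp)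
      exact ⟨a, _, hI, Or.inr ⟨rfl, h1⟩⟩
  choose own x hx hxv using hown
  have huniq : ∀ v a, ∀ y ∈ π a, EndptIn G y.1 y.2 v → a = own v := fun v a y hy hyv =>
    hinj (hVD v _ ⟨a, rfl⟩ _ ⟨own v, rfl⟩ y hy (x v) (hx v) hyv (hxv v))
  let F : Finset (Edges G) := Finset.univ.filter fun e => own e.val.1 ≠ own e.val.2
  have hF : ∀ e, e ∉ F → own e.val.1 = own e.val.2 := fun e he => by simpa [F] using he
  have hset : {p | ∃ f ∈ F, p = s(f.val.1, f.val.2)} =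
      ((F.image fun f => s(f.val.1, f.val.2) : Finset (Sym2 V)) : Set (Sym2 V)) := by
    ext p
    simp only [Set.mem_ofPred_eq, Finset.coe_image, Set.mem_image, Finset.mem_coe, eq_comm]
  refine ⟨F, ?_, ?_⟩
  · have hcard := card_connectedComponent_add_card_le hacyc
      (F.image fun f => s(f.val.1, f.val.2)) (by
        intro e he
        obtain ⟨f, -, rfl⟩ := Finset.mem_image.mp he
        exact f.prop.2)
    rw [Finset.card_image_of_injective _ fun _ _ => Edges.ext_of_sym2_eq, ← hset] at hcard
    have hpos : 0 < Nat.card G.ConnectedComponent := by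
      have := hconn.nonempty
      exact Nat.card_pos
    have hcomp :
        Nat.card (G.deleteEdges {p | ∃ f ∈ F, p = s(f.val.1, f.val.2)}).ConnectedComponent
        ≤ Nat.card A := by
      refine Nat.card_le_card_of_injective (fun C => own C.out) fun C D hCD => ?_
      rw [← C.out_eq, ← D.out_eq]
      refine SimpleGraph.ConnectedComponent.sound
        ((hPart.1 _ ⟨own C.out, rfl⟩).reachable ?_ (hx _) ?_ (hxv _) (hxv D.out))
      · intro y hy h0 h1
        refine SimpleGraph.deleteEdges_adj.mpr ⟨y.1.prop.2, ?_⟩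
        rintro ⟨f, hf, hyf⟩
        rw [← Edges.ext_of_sym2_eq hyf] at hf
        exact (Finset.mem_filter.mp hf).2 ((huniq _ _ y hy (Or.inl ⟨rfl, h0⟩)).symm.trans
          (huniq _ _ y hy (Or.inr ⟨rfl, h1⟩)))
      · have hCD : own C.out = own D.out := hCD
        rw [hCD]
        exact hx D.out
    rw [Nat.card_eq_fintype_card (α := A)] at hcomp
    omega
  · have hadj : ∀ v w, (G.deleteEdges {p | ∃ f ∈ F, p = s(f.val.1, f.val.2)}).Adj v w →
        own v = own w := by
      intro v w hvw
      obtain ⟨hG, hnot⟩ := SimpleGraph.deleteEdges_adj.mp hvw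
      rcases lt_or_gt_of_ne hG.ne with hlt | hlt
      · exact hF ⟨(v, w), hlt, hG⟩ fun hmem => hnot ⟨_, hmem, rfl⟩
      · exact (hF ⟨(w, v), hlt, hG.symm⟩ fun hmem => hnot ⟨_, hmem, Sym2.eq_swap⟩).symm
    have hreach : ∀ v w, (G.deleteEdges {p | ∃ f ∈ F, p = s(f.val.1, f.val.2)}).Reachable v w →
        own v = own w := by
      rintro v w ⟨p⟩
      induction p with
      | nil => rfl
      | cons h _ ih => exact (hadj _ _ h).trans ih
    intro C
    induction C using SimpleGraph.ConnectedComponent.ind with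
    | _ v =>
      refine ⟨own v, fun e he heC α hα P hP I hI hαI => ?_⟩
      have hv := hreach _ _ (SimpleGraph.ConnectedComponent.exact heC)
      obtain ⟨a₀, I₀, hI₀, h0⟩ := hcover e 0 (by simp)
      obtain ⟨a₁, I₁, hI₁, h1⟩ := hcover e 1 (by simp)
      have ha₀ : a₀ = own v := (huniq _ _ _ hI₀ (Or.inl ⟨rfl, h0⟩)).trans hv
      have ha₁ : a₁ = own v :=
        (huniq _ _ _ hI₁ (Or.inr ⟨rfl, h1⟩)).trans ((hF e he).symm.trans hv)
      subst ha₀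
      rw [ha₁] at hI₁
      exact hPart.eq_of_mem_of_mem hacyc ⟨_, rfl⟩ hP hI₀ hI₁ h0 h1 hα hI hαI

end GraphCutting
end

section
/- Let G be a finite tree, A a finite nonempty set, Π a partition of G into pieces, and π : A → Π a bijection. Let U be the set of vertices v of G such that at least two distinct members of Π contain a piece of an edge incident to v whose interval contains the endpoint corresponding to v, and let F be the set of edges e of G such that at least two distinct members of Π contain a nonempty piece of e. Then |U| + |F| ≤ |A|. -/
namespace GraphCutting

section Rooted

variable {V : Type*} {G : SimpleGraph V} {r a b c v w : V}

/-- In the graph `G` rooted at `r`, the vertex `a` is a parent of `b`. -/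
def IsParent (G : SimpleGraph V) (r a b : V) : Prop :=
  G.Adj a b ∧ G.dist r b = G.dist r a + 1

/-- In the graph `G` rooted at `r`, the vertex `w` is a (not necessarily proper)
descendant of `v`. -/
def IsDescendant (G : SimpleGraph V) (r v w : V) : Prop :=
  Relation.ReflTransGen (IsParent G r) v w

theorem IsParent.unique (hconn : G.Connected) (hacyc : G.IsAcyclic)
    (ha : IsParent G r a c) (hb : IsParent G r b c) : a = b := by
  have key : ∀ {x}, IsParent G r x c →
      ∃ (p : G.Walk r x) (h : G.Adj x c), (p.concat h).IsPath := by
    intro x hx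
    obtain ⟨p, hp⟩ := hconn.exists_walk_length_eq_dist r x
    refine ⟨p, hx.1, SimpleGraph.Walk.isPath_of_length_eq_dist _ ?_⟩
    rw [SimpleGraph.Walk.length_concat, hp, hx.2]
  obtain ⟨p, hp, hppath⟩ := key ha
  obtain ⟨q, hq, hqpath⟩ := key hb
  have heq := congrArg Subtype.val
    ((hacyc.subsingleton_path r c).elim ⟨_, hppath⟩ ⟨_, hqpath⟩)
  exact (SimpleGraph.Walk.concat_inj heq).1

theorem IsDescendant.dist_le (h : IsDescendant G r v w) : G.dist r v ≤ G.dist r w := by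
  induction h with
  | refl => exact le_rfl
  | tail _ hbc ih => exact ih.trans (by rw [hbc.2]; omega)

theorem IsDescendant.eq_of_dist_le (h : IsDescendant G r v w)
    (hle : G.dist r w ≤ G.dist r v) : v = w := by
  rcases Relation.ReflTransGen.cases_tail h with h | ⟨x, hvx, hxw⟩
  · exact h.symm
  · have h₁ : G.dist r v ≤ G.dist r x := IsDescendant.dist_le hvx
    have h₂ := hxw.2
    omega

theorem IsDescendant.antisymm (h : IsDescendant G r v w) (h' : IsDescendant G r w v) : v = w :=
  h.eq_of_dist_le h'.dist_le

/-- A parent of a proper descendant is a descendant. -/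
theorem IsDescendant.of_isParent (hconn : G.Connected) (hacyc : G.IsAcyclic)
    (h : IsDescendant G r v w) (hne : w ≠ v) (ha : IsParent G r a w) : IsDescendant G r v a := by
  rcases Relation.ReflTransGen.cases_tail h with h | ⟨x, hvx, hxw⟩
  · exact absurd h hne
  · rwa [ha.unique hconn hacyc hxw]

end Rooted

section Pieces

variable {V : Type*} [LinearOrder V] {G : SimpleGraph V} {r v w : V} {e f : Edges G}
  {P Q : Finset (Edges G × Set ℝ)} {Part : Set (Finset (Edges G × Set ℝ))}

open Classical in
/-- The endpoint of the edge `e` closer to the root `r`. -/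
noncomputable def upper (G : SimpleGraph V) (r : V) (e : Edges G) : V :=
  if G.dist r e.val.1 < G.dist r e.val.2 then e.val.1 else e.val.2

open Classical in
/-- The endpoint of the edge `e` farther from the root `r`. -/
noncomputable def lower (G : SimpleGraph V) (r : V) (e : Edges G) : V :=
  if G.dist r e.val.1 < G.dist r e.val.2 then e.val.2 else e.val.1

theorem isParent_upper_lower (hconn : G.Connected) (hacyc : G.IsAcyclic) (r : V) (e : Edges G) :
    IsParent G r (upper G r e) (lower G r e) := by
  have h := hacyc.dist_eq_dist_add_one_of_adj_of_reachable r e.2.2 (hconn r _)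
  unfold upper lower
  split_ifs with hlt
  · exact ⟨e.2.2, by omega⟩
  · exact ⟨e.2.2.symm, by omega⟩

theorem EndptIn.eq_upper_or_eq_lower {I : Set ℝ} (r : V) (h : EndptIn G e I v) :
    v = upper G r e ∨ v = lower G r e := by
  unfold upper lower
  rcases h with ⟨h, -⟩ | ⟨h, -⟩ <;> split_ifs <;> simp [h]

theorem eq_of_lower_eq (hconn : G.Connected) (hacyc : G.IsAcyclic)
    (h : lower G r e = lower G r f) : e = f := by
  have h' : upper G r e = upper G r f :=
    (isParent_upper_lower hconn hacyc r e).unique hconn hacyc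
      (h ▸ isParent_upper_lower hconn hacyc r f)
  have he := e.2.1
  have hf := f.2.1
  unfold upper at h'
  unfold lower at h
  apply Subtype.ext
  apply Prod.ext <;> split_ifs at h h' <;> first | assumption | (exfalso; order)

/-- The endpoint of an edge at a given vertex lies in a single member of a partition. -/
theorem IsPartition.eq_of_endptIn (hPart : IsPartition G Part) (hP : P ∈ Part) (hQ : Q ∈ Part)
    {I J : Set ℝ} (hI : (e, I) ∈ P) (hJ : (e, J) ∈ Q) (hvI : EndptIn G e I v)
    (hvJ : EndptIn G e J v) : P = Q := by
  have key : ∀ α ∈ Set.Icc (0 : ℝ) 1, α ∈ I → α ∈ J → P = Q := fun α hα h₁ h₂ =>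
    congrArg Prod.fst ((hPart.2 e α hα).unique (y₁ := (P, I)) (y₂ := (Q, J))
      ⟨hP, hI, h₁⟩ ⟨hQ, hJ, h₂⟩)
  have hne := e.2.1.ne
  rcases hvI with ⟨h₁, hI⟩ | ⟨h₁, hI⟩ <;> rcases hvJ with ⟨h₂, hJ⟩ | ⟨h₂, hJ⟩
  · exact key 0 (by simp) hI hJ
  · exact absurd (h₁.symm.trans h₂) hne
  · exact absurd (h₂.symm.trans h₁) hne
  · exact key 1 (by simp) hI hJ

/-- The piece `P` contains the vertex `v`, but not through the edge joining `v` to its parent. -/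
def IsTopVertex (r v : V) (P : Finset (Edges G × Set ℝ)) : Prop :=
  (∃ x ∈ P, EndptIn G x.1 x.2 v) ∧ ∀ x ∈ P, lower G r x.1 = v → ¬ EndptIn G x.1 x.2 v

/-- The piece `P` meets the edge `e`, but does not contain its endpoint closer to the root. -/
def IsTopEdge (r : V) (e : Edges G) (P : Finset (Edges G × Set ℝ)) : Prop :=
  (∃ I, (e, I) ∈ P) ∧ ∀ I, (e, I) ∈ P → ¬ EndptIn G e I (upper G r e)

/-- A property of edges that holds for one member of a piece and is preserved by
adjacency holds for all members. -/
theorem IsPiece.induction (hP : IsPiece G P) {p : Edges G → Prop} {x : Edges G × Set ℝ}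
    (hx : x ∈ P) (hpx : p x.1)
    (hstep : ∀ y ∈ P, ∀ z ∈ P, ∀ w, EndptIn G y.1 y.2 w → EndptIn G z.1 z.2 w → p y.1 → p z.1) :
    ∀ y ∈ P, p y.1 := by
  intro y hy
  induction hP.2 x hx y hy with
  | refl => exact hpx
  | tail _ hbc ih =>
    obtain ⟨hb, hc, -, w, hw₁, hw₂⟩ := hbc
    exact hstep _ hb _ hc w hw₁ hw₂ (ih hb)

theorem IsTopVertex.isDescendant (hconn : G.Connected) (hacyc : G.IsAcyclic) (hP : IsPiece G P)
    (h : IsTopVertex r v P) : ∀ x ∈ P, IsDescendant G r v (upper G r x.1) := by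
  obtain ⟨⟨x, hx, hxv⟩, htop⟩ := h
  refine hP.induction (p := fun e => IsDescendant G r v (upper G r e)) hx ?_ ?_
  · rcases hxv.eq_upper_or_eq_lower r with h | h
    · rw [← h]
      exact Relation.ReflTransGen.refl
    · exact absurd hxv (htop x hx h.symm)
  · intro y hy z hz w hyw hzw hdesc
    have hw : IsDescendant G r v w := by
      rcases hyw.eq_upper_or_eq_lower r with rfl | rfl
      · exact hdesc
      · exact hdesc.tail (isParent_upper_lower hconn hacyc r y.1)
    rcases hzw.eq_upper_or_eq_lower r with h | h
    · rwa [← h]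
    · have hne : w ≠ v := by
        rintro rfl
        exact htop z hz h.symm hzw
      exact hw.of_isParent hconn hacyc hne (h ▸ isParent_upper_lower hconn hacyc r z.1)

theorem IsTopEdge.isDescendant (hconn : G.Connected) (hacyc : G.IsAcyclic) (hP : IsPiece G P)
    (h : IsTopEdge r e P) : ∀ x ∈ P, IsDescendant G r (lower G r e) (lower G r x.1) := by
  obtain ⟨⟨I, hI⟩, htop⟩ := h
  refine hP.induction (p := fun f => IsDescendant G r (lower G r e) (lower G r f)) hI
    Relation.ReflTransGen.refl ?_
  rintro ⟨f, K⟩ hy z hz w hyw hzw hdesc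
  have hw : IsDescendant G r (lower G r e) w := by
    rcases hyw.eq_upper_or_eq_lower r with rfl | rfl
    · refine hdesc.of_isParent hconn hacyc ?_ (isParent_upper_lower hconn hacyc r f)
      intro heq
      obtain rfl := eq_of_lower_eq hconn hacyc heq
      exact htop K hy hyw
    · exact hdesc
  rcases hzw.eq_upper_or_eq_lower r with rfl | rfl
  · exact hw.tail (isParent_upper_lower hconn hacyc r z.1)
  · exact hw

theorem IsTopVertex.unique (hconn : G.Connected) (hacyc : G.IsAcyclic) (hP : IsPiece G P)
    (hv : IsTopVertex r v P) (hw : IsTopVertex r w P) : v = w := by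
  have key : ∀ {a b : V}, IsTopVertex r a P → IsTopVertex r b P → IsDescendant G r a b := by
    intro a b ha hb
    obtain ⟨x, hx, hxb⟩ := hb.1
    have hdesc := ha.isDescendant hconn hacyc hP x hx
    rcases hxb.eq_upper_or_eq_lower r with h | h
    · rwa [h]
    · exact absurd hxb (hb.2 x hx h.symm)
  exact (key hv hw).antisymm (key hw hv)

theorem IsTopEdge.unique (hconn : G.Connected) (hacyc : G.IsAcyclic) (hP : IsPiece G P)
    (he : IsTopEdge r e P) (hf : IsTopEdge r f P) : e = f := by
  obtain ⟨I, hI⟩ := he.1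
  obtain ⟨J, hJ⟩ := hf.1
  exact eq_of_lower_eq hconn hacyc
    ((he.isDescendant hconn hacyc hP _ hJ).antisymm (hf.isDescendant hconn hacyc hP _ hI))

theorem IsTopVertex.not_isTopEdge (hconn : G.Connected) (hacyc : G.IsAcyclic) (hP : IsPiece G P)
    (hv : IsTopVertex r v P) : ¬ IsTopEdge r e P := by
  intro he
  obtain ⟨⟨f, K⟩, hx, hxv⟩ := hv.1
  obtain ⟨I, hI⟩ := he.1
  have hup : v = upper G r f := (hxv.eq_upper_or_eq_lower r).resolve_right
    fun h => hv.2 _ hx h.symm hxv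
  have h₁ := (hv.isDescendant hconn hacyc hP _ hI).dist_le
  have h₂ := he.isDescendant hconn hacyc hP _ hx
  have h₃ := (isParent_upper_lower hconn hacyc r e).2
  have h₄ := (isParent_upper_lower hconn hacyc r f).2
  rw [hup] at h₁
  obtain rfl : e = f := eq_of_lower_eq hconn hacyc (h₂.eq_of_dist_le (by simp only at *; omega))
  exact he.2 K hx (hup ▸ hxv)

theorem IsPartition.exists_isTopVertex (hconn : G.Connected) (hacyc : G.IsAcyclic)
    (hPart : IsPartition G Part) (r : V) (hP : P ∈ Part) (hQ : Q ∈ Part) (hne : P ≠ Q)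
    (hvP : ∃ x ∈ P, EndptIn G x.1 x.2 v) (hvQ : ∃ y ∈ Q, EndptIn G y.1 y.2 v) :
    ∃ R ∈ Part, IsTopVertex r v R := by
  by_contra! hcon
  have h₁ := hcon P hP
  have h₂ := hcon Q hQ
  simp only [IsTopVertex, hvP, hvQ, true_and] at h₁ h₂
  push Not at h₁ h₂
  obtain ⟨⟨e, I⟩, hI, he, hvI⟩ := h₁
  obtain ⟨⟨f, J⟩, hJ, hf, hvJ⟩ := h₂
  obtain rfl : e = f := eq_of_lower_eq hconn hacyc (he.trans hf.symm)
  exact hne (hPart.eq_of_endptIn hP hQ hI hJ hvI hvJ)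

theorem IsPartition.exists_isTopEdge (hPart : IsPartition G Part) (r : V) (hP : P ∈ Part)
    (hQ : Q ∈ Part) (hne : P ≠ Q) (heP : ∃ I, (e, I) ∈ P) (heQ : ∃ J, (e, J) ∈ Q) :
    ∃ R ∈ Part, IsTopEdge r e R := by
  by_contra! hcon
  have h₁ := hcon P hP
  have h₂ := hcon Q hQ
  simp only [IsTopEdge, heP, heQ, true_and] at h₁ h₂
  push Not at h₁ h₂
  obtain ⟨I, hI, hvI⟩ := h₁
  obtain ⟨J, hJ, hvJ⟩ := h₂
  exact hne (hPart.eq_of_endptIn hP hQ hI hJ hvI hvJ)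

end Pieces

/-- for a finite tree `G`, a partition `Part` of `G` into pieces and a
bijection `π : A → Part`, the number of vertices `v` such that at least two members of
`Part` contain a piece of an edge incident to `v` whose interval contains the endpoint
corresponding to `v`, plus the number of edges of which at least two members of `Part`
contain a nonempty piece, is at most `|A|`. -/
theorem stmt13 {V : Type*} [Fintype V] [LinearOrder V] (G : SimpleGraph V)
    (hconn : G.Connected) (hacyc : G.IsAcyclic)
    {A : Type*} [Fintype A] [Nonempty A]
    (Part : Set (Finset (Edges G × Set ℝ))) (π : A → Finset (Edges G × Set ℝ))
    (hPart : IsPartition G Part)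
    (hinj : Function.Injective π) (hrange : Set.range π = Part) :
    Set.ncard {v : V | ∃ P ∈ Part, ∃ Q ∈ Part, P ≠ Q ∧
        (∃ x ∈ P, EndptIn G x.1 x.2 v) ∧ (∃ y ∈ Q, EndptIn G y.1 y.2 v)} +
    Set.ncard {e : Edges G | ∃ P ∈ Part, ∃ Q ∈ Part, P ≠ Q ∧
        (∃ I, (e, I) ∈ P ∧ I.Nonempty) ∧ (∃ J, (e, J) ∈ Q ∧ J.Nonempty)}
      ≤ Fintype.card A := by
  obtain ⟨r⟩ := hconn.nonempty
  set U := {v : V | ∃ P ∈ Part, ∃ Q ∈ Part, P ≠ Q ∧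
    (∃ x ∈ P, EndptIn G x.1 x.2 v) ∧ (∃ y ∈ Q, EndptIn G y.1 y.2 v)}
  set F := {e : Edges G | ∃ P ∈ Part, ∃ Q ∈ Part, P ≠ Q ∧
    (∃ I, (e, I) ∈ P ∧ I.Nonempty) ∧ (∃ J, (e, J) ∈ Q ∧ J.Nonempty)}
  have hpiece : ∀ a, IsPiece G (π a) := fun a => hPart.1 _ (hrange ▸ Set.mem_range_self a)
  have hU : ∀ v : U, ∃ a, IsTopVertex r v.1 (π a) := by
    rintro ⟨v, P, hP, Q, hQ, hne, hvP, hvQ⟩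
    obtain ⟨R, hR, htop⟩ := hPart.exists_isTopVertex hconn hacyc r hP hQ hne hvP hvQ
    rw [← hrange] at hR
    obtain ⟨a, rfl⟩ := hR
    exact ⟨a, htop⟩
  have hF : ∀ e : F, ∃ a, IsTopEdge r e.1 (π a) := by
    rintro ⟨e, P, hP, Q, hQ, hne, ⟨I, hI, -⟩, ⟨J, hJ, -⟩⟩
    obtain ⟨R, hR, htop⟩ := hPart.exists_isTopEdge r hP hQ hne ⟨I, hI⟩ ⟨J, hJ⟩
    rw [← hrange] at hR
    obtain ⟨a, rfl⟩ := hR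
    exact ⟨a, htop⟩
  choose g hg using hU
  choose k hk using hF
  have hinjective : Function.Injective (Sum.elim g k) := by
    refine Function.Injective.sumElim ?_ ?_ ?_
    · intro v w h
      exact Subtype.ext ((hg v).unique hconn hacyc (hpiece _) (h ▸ hg w))
    · intro e f h
      exact Subtype.ext ((hk e).unique hconn hacyc (hpiece _) (h ▸ hk f))
    · intro v e h
      exact (hg v).not_isTopEdge hconn hacyc (hpiece _) (h ▸ hk e)
  have hcard := Nat.card_le_card_of_injective _ hinjective
  rwa [Nat.card_sum, Nat.card_coe_set_eq, Nat.card_coe_set_eq, Nat.card_eq_fintype_card] at hcard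

end GraphCutting
end

section
/- Let G be a finite cycle graph, A a finite nonempty set, Π a partition of G into pieces, and π : A → Π a bijection. Then the number of edges e of G such that at least two distinct members of Π contain a nonempty piece of e is at most |A|. -/
namespace GraphCutting

/-- A connected finite graph of maximum degree at most two has at most two vertices of degree
at most one. -/
theorem card_degree_le_one_le_two {W : Type*} [Fintype W] (H : SimpleGraph W)
    [DecidableRel H.Adj] (hH : H.Preconnected) (h2 : ∀ w, H.degree w ≤ 2) :
    (Finset.univ.filter fun w => H.degree w ≤ 1).card ≤ 2 := by
  classical
  rcases isEmpty_or_nonempty W with hW | hW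
  · simp
  have hc : H.Connected := ⟨hH⟩
  have h1 := hc.card_vert_le_card_edgeSet_add_one
  rw [Nat.card_eq_fintype_card, Nat.card_eq_fintype_card, ← SimpleGraph.edgeFinset_card] at h1
  have h3 := H.sum_degrees_eq_twice_card_edges
  have h4 : ∑ w, (H.degree w + if H.degree w ≤ 1 then 1 else 0) ≤ ∑ _w : W, 2 :=
    Finset.sum_le_sum fun w _ => by
      have := h2 w
      split_ifs <;> omega
  rw [Finset.sum_add_distrib, ← Finset.card_filter] at h4
  simp only [Finset.sum_const, Finset.card_univ, smul_eq_mul] at h4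
  omega

variable {V : Type*} [LinearOrder V] {G : SimpleGraph V}

/-- The adjacency graph of the members of a finite collection of pieces of edges. -/
def pieceGraph (G : SimpleGraph V) (P : Finset (Edges G × Set ℝ)) : SimpleGraph P where
  Adj x y := PieceAdj G x y
  symm := ⟨fun _ _ h => ⟨h.1.symm, h.2.imp fun _ hv => ⟨hv.2, hv.1⟩⟩⟩
  loopless := ⟨fun _ h => h.1 rfl⟩

theorem IsPiece.preconnected_pieceGraph {P : Finset (Edges G × Set ℝ)} (hP : IsPiece G P) :
    (pieceGraph G P).Preconnected := by
  rintro ⟨x, hx⟩ ⟨y, hy⟩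
  have key : ∀ z, Relation.ReflTransGen (fun a b => a ∈ P ∧ b ∈ P ∧ PieceAdj G a b) x z →
      ∃ hz : z ∈ P, (pieceGraph G P).Reachable ⟨x, hx⟩ ⟨z, hz⟩ := by
    intro z h
    induction h with
    | refl => exact ⟨hx, .rfl⟩
    | tail _ hbc ih =>
      obtain ⟨hb, hr⟩ := ih
      refine ⟨hbc.2.1, hr.trans (SimpleGraph.Adj.reachable ?_)⟩
      exact hbc.2.2
  exact (key y (hP.2 x hx y hy)).2

theorem EndptIn.eq_fst_or_eq_snd {e : Edges G} {I : Set ℝ} {v : V} (h : EndptIn G e I v) :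
    v = e.val.1 ∨ v = e.val.2 :=
  h.imp And.left And.left

/-- At a vertex of degree two, at most one edge differs from a given edge. -/
theorem edge_eq_of_ne_of_ne {v : V} [Fintype (G.neighborSet v)] (hv : G.degree v = 2)
    {e f f' : Edges G} (he : v = e.val.1 ∨ v = e.val.2) (hf : v = f.val.1 ∨ v = f.val.2)
    (hf' : v = f'.val.1 ∨ v = f'.val.2) (hef : e ≠ f) (hef' : e ≠ f') : f = f' := by
  obtain ⟨a, b, -, hab⟩ := Finset.card_eq_two.1 hv
  have hN : ∀ w, G.Adj v w → w = a ∨ w = b := fun w hw => by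
    have : w ∈ G.neighborFinset v := (G.mem_neighborFinset v w).2 hw
    simpa [hab] using this
  obtain ⟨⟨e1, e2⟩, hel, hea⟩ := e
  obtain ⟨⟨f1, f2⟩, hfl, hfa⟩ := f
  obtain ⟨⟨g1, g2⟩, hgl, hga⟩ := f'
  have hea' := hea.symm
  have hfa' := hfa.symm
  have hga' := hga.symm
  simp only [ne_eq, Subtype.mk.injEq, Prod.mk.injEq] at *
  rcases he with rfl | rfl <;> rcases hf with rfl | rfl <;> rcases hf' with rfl | rfl <;> grind

/-- The members of a partition containing a given point of an edge coincide, and so do the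
corresponding intervals. -/
theorem IsPartition.eq_and_eq {Part : Set (Finset (Edges G × Set ℝ))} (h : IsPartition G Part)
    {P Q : Finset (Edges G × Set ℝ)} (hP : P ∈ Part) (hQ : Q ∈ Part) {e : Edges G}
    {I J : Set ℝ} (hI : (e, I) ∈ P) (hJ : (e, J) ∈ Q) {α : ℝ} (hαI : α ∈ I) (hαJ : α ∈ J) :
    P = Q ∧ I = J := by
  have := (h.2 e α (((h.1 P hP).1 _ hI).1 hαI)).unique (y₁ := (P, I)) (y₂ := (Q, J))
    ⟨hP, hI, hαI⟩ ⟨hQ, hJ, hαJ⟩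
  simpa using this

/-- Adjacent pieces of edges within a member of a partition of a graph that is regular of degree
two are determined by the vertex at which they meet. -/
theorem IsPartition.degree_pieceGraph_le [Fintype V] [DecidableRel G.Adj]
    (hdeg : ∀ v : V, G.degree v = 2)
    {Part : Set (Finset (Edges G × Set ℝ))} (h : IsPartition G Part)
    {P : Finset (Edges G × Set ℝ)} (hP : P ∈ Part) [DecidableRel (pieceGraph G P).Adj] (x : P)
    (T : Finset V) (hT : ∀ v, EndptIn G x.1.1 x.1.2 v → v ∈ T) :
    (pieceGraph G P).degree x ≤ T.card := by
  classical
  rw [← SimpleGraph.card_neighborFinset_eq_degree]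
  have hex : ∀ y ∈ (pieceGraph G P).neighborFinset x, x.1.1 ≠ y.1.1 ∧
      ∃ v : V, EndptIn G x.1.1 x.1.2 v ∧ EndptIn G y.1.1 y.1.2 v := fun y hy =>
    (SimpleGraph.mem_neighborFinset _ _ _).1 hy
  have : Nonempty V := ⟨x.1.1.val.1⟩
  choose! hne m hm using hex
  refine Finset.card_le_card_of_injOn m (fun y hy => hT _ (hm y hy).1) ?_
  intro y hy z hz hyz
  have hy1 := hm y hy
  have hz1 := hm z hz
  rw [← hyz] at hz1
  have hyze := edge_eq_of_ne_of_ne (hdeg (m y)) hy1.1.eq_fst_or_eq_snd hy1.2.eq_fst_or_eq_snd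
    hz1.2.eq_fst_or_eq_snd (hne y hy) (hne z hz)
  obtain ⟨⟨f, I⟩, hyP⟩ := y
  obtain ⟨⟨f', J⟩, hzP⟩ := z
  obtain rfl : f = f' := hyze
  have hlt := f.2.1
  rcases hy1.2 with ⟨h1, h0⟩ | ⟨h1, h0⟩ <;> rcases hz1.2 with ⟨h2, h3⟩ | ⟨h2, h3⟩
  · obtain ⟨-, rfl⟩ := h.eq_and_eq hP hP hyP hzP h0 h3
    rfl
  · exact absurd (h1.symm.trans h2) hlt.ne
  · exact absurd (h2.symm.trans h1) hlt.ne
  · obtain ⟨-, rfl⟩ := h.eq_and_eq hP hP hyP hzP h0 h3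
    rfl

/-- The edges of which at least two distinct members of `Part` contain a nonempty piece. -/
def sharedEdges (Part : Set (Finset (Edges G × Set ℝ))) : Set (Edges G) :=
  {e : Edges G | ∃ P ∈ Part, ∃ Q ∈ Part, P ≠ Q ∧
    (∃ I, (e, I) ∈ P ∧ I.Nonempty) ∧ (∃ J, (e, J) ∈ Q ∧ J.Nonempty)}

theorem IsPartition.not_mem_zero_and_one {Part : Set (Finset (Edges G × Set ℝ))}
    (h : IsPartition G Part) {P : Finset (Edges G × Set ℝ)} (hP : P ∈ Part) {e : Edges G}
    {I : Set ℝ} (hI : (e, I) ∈ P) (he : e ∈ sharedEdges Part) : ¬ ((0 : ℝ) ∈ I ∧ (1 : ℝ) ∈ I) := by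
  rintro ⟨h0, h1⟩
  obtain ⟨Q, hQ, R, hR, hne, ⟨J, hJ, α, hα⟩, ⟨K, hK, β, hβ⟩⟩ := he
  have hIcc := ((h.1 P hP).1 _ hI).2.out h0 h1
  have hQP := (h.eq_and_eq hP hQ hI hJ (hIcc (((h.1 Q hQ).1 _ hJ).1 hα)) hα).1
  have hRP := (h.eq_and_eq hP hR hI hK (hIcc (((h.1 R hR).1 _ hK).1 hβ)) hβ).1
  exact hne (hQP.symm.trans hRP)

/-- In a graph that is regular of degree two, a member of a partition meets at most two shared
edges. -/
theorem IsPartition.card_sharedEdges_le_two [Fintype V] [DecidableRel G.Adj]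
    (hdeg : ∀ v : V, G.degree v = 2)
    {Part : Set (Finset (Edges G × Set ℝ))} (h : IsPartition G Part)
    {P : Finset (Edges G × Set ℝ)} (hP : P ∈ Part) (S : Finset (Edges G))
    (hS : ∀ e ∈ S, e ∈ sharedEdges Part ∧ ∃ I, (e, I) ∈ P) : S.card ≤ 2 := by
  classical
  have hle2 : ∀ x, (pieceGraph G P).degree x ≤ 2 := fun x =>
    (h.degree_pieceGraph_le hdeg hP x {x.1.1.val.1, x.1.1.val.2}
      fun v hv => by simpa using hv.eq_fst_or_eq_snd).trans Finset.card_le_two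
  refine le_trans ?_ (card_degree_le_one_le_two _ (h.1 P hP).preconnected_pieceGraph hle2)
  refine Finset.card_le_card_of_surjOn (fun x => x.1.1) fun e he => ?_
  obtain ⟨hes, I, hI⟩ := hS e he
  refine ⟨⟨(e, I), hI⟩, ?_, rfl⟩
  simp only [Finset.coe_filter, Finset.mem_univ, true_and, Set.mem_ofPred_eq]
  have hnot := h.not_mem_zero_and_one hP hI hes
  by_cases h0 : (0 : ℝ) ∈ I
  · refine (h.degree_pieceGraph_le hdeg hP _ {e.val.1} fun v hv => ?_).trans
      (Finset.card_singleton _).le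
    rcases hv with hv | hv
    · simpa using hv.1
    · exact absurd ⟨h0, hv.2⟩ hnot
  · refine (h.degree_pieceGraph_le hdeg hP _ {e.val.2} fun v hv => ?_).trans
      (Finset.card_singleton _).le
    rcases hv with hv | hv
    · exact absurd hv.2 h0
    · simpa using hv.1

end GraphCutting

namespace GraphCutting

/-- for a finite cycle graph `G` (connected with every vertex of degree
exactly `2`), a partition `Part` of `G` into pieces and a bijection `π : A → Part`, the
number of edges of which at least two distinct members of `Part` contain a nonempty
piece is at most `|A|`. -/
theorem stmt14 {V : Type*} [Fintype V] [LinearOrder V]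
    (G : SimpleGraph V) [DecidableRel G.Adj]
    (hconn : G.Connected) (hdeg : ∀ v : V, G.degree v = 2)
    {A : Type*} [Fintype A] [Nonempty A]
    (Part : Set (Finset (Edges G × Set ℝ))) (π : A → Finset (Edges G × Set ℝ))
    (hPart : IsPartition G Part)
    (hinj : Function.Injective π) (hrange : Set.range π = Part) :
    Set.ncard {e : Edges G | ∃ P ∈ Part, ∃ Q ∈ Part, P ≠ Q ∧
        (∃ I, (e, I) ∈ P ∧ I.Nonempty) ∧ (∃ J, (e, J) ∈ Q ∧ J.Nonempty)}
      ≤ Fintype.card A := by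
  classical
  change (sharedEdges Part).ncard ≤ _
  rw [Set.ncard_eq_toFinset_card' (sharedEdges Part), ← Finset.card_univ]
  let r : Edges G → A → Prop := fun e a => ∃ I, (e, I) ∈ π a ∧ I.Nonempty
  have hcount := Finset.card_mul_le_card_mul (s := (sharedEdges Part).toFinset)
    (t := (Finset.univ : Finset A)) r (m := 2) (n := 2) ?_ ?_
  · omega
  · intro e he
    obtain ⟨P, hP, Q, hQ, hne, hPe, hQe⟩ := Set.mem_toFinset.1 he
    rw [← hrange] at hP hQ
    obtain ⟨a, rfl⟩ := hP
    obtain ⟨b, rfl⟩ := hQ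
    exact Finset.one_lt_card.2 ⟨a, by simpa [Finset.bipartiteAbove, r] using hPe,
      b, by simpa [Finset.bipartiteAbove, r] using hQe, fun hab => hne (hab ▸ rfl)⟩
  · intro a _
    refine hPart.card_sharedEdges_le_two hdeg (hrange ▸ Set.mem_range_self a) _ fun e he => ?_
    obtain ⟨hes, I, hI, -⟩ := Finset.mem_filter.1 he
    exact ⟨Set.mem_toFinset.1 hes, I, hI⟩

end GraphCutting
end
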